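/- arXiv:math/0310382 — 4 statements merged into one kernel-verified Lean document; each statement's English description precedes it below -/
import Mathlib

section
/- Let μ, ν be nonnegative integers and set C(μ,ν) = (μ!·ν!/(μ+ν+4)!)·(binom(μ+ν+2, μ+1) − 1) and a₂ = 6/π². There is a constant K depending only on μ and ν such that for all t ≥ 3 and all primes p ≤ t, |Σ_{n≤t} d^{(μ)}(n)·d^{(ν)}(pn)/n − a₂·(2·C(μ,ν)·l^{μ+ν+4} + Σ_{k=0}^{ν−1} binom(ν,k)·(log p)^{ν−k}·l^{μ+k+4}·C(μ,k))| ≤ K·(l^{μ+ν+4}/p + l^{μ+ν+3}), where l = log t and the sum over k is empty when ν = 0. -/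
open Complex

/-- `d^{(μ,ν)}(n) = Σ_{ab=n} (log a)^μ (log b)^ν`. -/
noncomputable def dGen (μ ν : ℕ) (n : ℕ) : ℝ :=
  ∑ x ∈ n.divisorsAntidiagonal, Real.log x.1 ^ μ * Real.log x.2 ^ ν

/-- `d^{(μ)}(n) = d^{(μ,0)}(n)`. -/
noncomputable def dLog (μ : ℕ) (n : ℕ) : ℝ := dGen μ 0 n

/-- The constant `C(μ,ν) = (μ!ν!/(μ+ν+4)!)(binom(μ+ν+2,μ+1) − 1)`. -/
noncomputable def Cconst (μ ν : ℕ) : ℝ :=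
  (Nat.factorial μ : ℝ) * (Nat.factorial ν : ℝ) / (Nat.factorial (μ + ν + 4) : ℝ) *
    ((Nat.choose (μ + ν + 2) (μ + 1) : ℝ) - 1)

theorem abs_add_pow_sub_linear_le (a : ℕ) :
    ∃ C : ℝ, 0 ≤ C ∧ ∀ L δ : ℝ, 0 ≤ L → 0 ≤ δ → δ ≤ 1 →
      |(L + δ) ^ (a + 1) - L ^ (a + 1) - (a + 1) * L ^ a * δ| ≤ C * (1 + L) ^ a * δ ^ 2 := by
  induction a with
  | zero => exact ⟨0, le_rfl, fun L δ _ _ _ => by simp⟩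
  | succ a ih =>
    obtain ⟨C, hC, h⟩ := ih
    refine ⟨a + 1 + C, by positivity, fun L δ hL hδ hδ1 => ?_⟩
    have key : (L + δ) ^ (a + 1 + 1) - L ^ (a + 1 + 1) - ((a + 1 : ℕ) + 1) * L ^ (a + 1) * δ =
        (a + 1) * L ^ a * δ ^ 2 +
          (L + δ) * ((L + δ) ^ (a + 1) - L ^ (a + 1) - (a + 1) * L ^ a * δ) := by
      push_cast; ring
    rw [key]
    refine (abs_add_le _ _).trans ?_
    rw [abs_mul (L + δ), abs_of_nonneg (by positivity : 0 ≤ (a + 1) * L ^ a * δ ^ 2),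
      abs_of_nonneg (by positivity : 0 ≤ L + δ)]
    have h1 : L ^ a ≤ (1 + L) ^ (a + 1) :=
      (pow_le_pow_left₀ hL (by linarith) a).trans (pow_le_pow_right₀ (by linarith) (by simp))
    have h2 := mul_le_mul (by linarith : L + δ ≤ 1 + L) (h L δ hL hδ hδ1) (abs_nonneg _)
      (by positivity)
    calc (a + 1) * L ^ a * δ ^ 2 +
          (L + δ) * |(L + δ) ^ (a + 1) - L ^ (a + 1) - (a + 1) * L ^ a * δ|
        ≤ (a + 1) * (1 + L) ^ (a + 1) * δ ^ 2 + (1 + L) * (C * (1 + L) ^ a * δ ^ 2) := by gcongr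
      _ = (a + 1 + C) * (1 + L) ^ (a + 1) * δ ^ 2 := by ring

theorem log_succ_sub_log_bounds {n : ℕ} (hn : 1 ≤ n) :
    0 ≤ Real.log (n + 1) - Real.log n ∧ Real.log (n + 1) - Real.log n ≤ 1 / n ∧
      1 / n - (Real.log (n + 1) - Real.log n) ≤ 1 / (n : ℝ) ^ 2 := by
  have hn' : (1 : ℝ) ≤ n := by exact_mod_cast hn
  have h0 : (0 : ℝ) < n := by linarith
  have e : Real.log (n + 1) - Real.log n = Real.log ((n + 1) / n) :=
    (Real.log_div (by positivity) (by positivity)).symm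
  have h1 := Real.log_le_sub_one_of_pos (by positivity : (0 : ℝ) < (n + 1) / n)
  have h2 := Real.one_sub_inv_le_log_of_pos (by positivity : (0 : ℝ) < (n + 1) / n)
  refine ⟨sub_nonneg.2 (Real.log_le_log h0 (by linarith)), ?_, ?_⟩
  · rw [e]; refine h1.trans (le_of_eq ?_); field_simp; ring
  · rw [e]
    have h3 : 1 - ((n + 1 : ℝ) / n)⁻¹ = 1 / (n + 1) := by field_simp; ring
    have h4 : 1 / (n : ℝ) - 1 / (n + 1) ≤ 1 / (n : ℝ) ^ 2 := by
      rw [div_sub_div _ _ (by positivity) (by positivity), div_le_div_iff₀ (by positivity)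
        (by positivity)]
      nlinarith
    linarith

theorem sum_log_pow_div_bound (a : ℕ) :
    ∃ K : ℝ, 0 ≤ K ∧ ∀ x : ℝ, 1 ≤ x →
      |(∑ n ∈ Finset.Icc 1 ⌊x⌋₊, Real.log n ^ a / n) - Real.log x ^ (a + 1) / (a + 1)| ≤
        K * (1 + Real.log x) ^ a := by
  obtain ⟨C, hC, h⟩ := abs_add_pow_sub_linear_le a
  have hsum : Summable (fun n : ℕ => 1 / (n : ℝ) ^ 2) :=
    Real.summable_one_div_nat_pow.2 one_lt_two
  set Z := ∑' n : ℕ, 1 / (n : ℝ) ^ 2 with hZ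
  have hZ0 : 0 ≤ Z := tsum_nonneg fun n => by positivity
  refine ⟨((C + (a + 1)) * Z + (a + 1) * 2 ^ a), by positivity, fun x hx => ?_⟩
  set l := Real.log x with hl
  have hl0 : 0 ≤ l := Real.log_nonneg hx
  set N := ⌊x⌋₊ with hN
  have hNx : (N : ℝ) ≤ x := Nat.floor_le (by linarith)
  have hxN : x < N + 1 := Nat.lt_floor_add_one x
  have tele : ∀ M : ℕ, ∑ n ∈ Finset.Icc 1 M,
      (Real.log (n + 1) ^ (a + 1) - Real.log n ^ (a + 1)) = Real.log (M + 1) ^ (a + 1) := by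
    intro M
    induction M with
    | zero => simp
    | succ M ih => rw [Finset.sum_Icc_succ_top (by simp), ih]; push_cast; ring
  have step : ∀ n ∈ Finset.Icc 1 N, |(a + 1) * (Real.log n ^ a / n) -
      (Real.log (n + 1) ^ (a + 1) - Real.log n ^ (a + 1))| ≤
        (C + (a + 1)) * (1 + l) ^ a * (1 / (n : ℝ) ^ 2) := by
    intro n hn
    obtain ⟨hn1, hnN⟩ := Finset.mem_Icc.1 hn
    have hn' : (1 : ℝ) ≤ n := by exact_mod_cast hn1
    have hnx : (n : ℝ) ≤ x := le_trans (by exact_mod_cast hnN) hNx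
    obtain ⟨b1, b2, b3⟩ := log_succ_sub_log_bounds hn1
    have hL : 0 ≤ Real.log n := Real.log_nonneg hn'
    have hLl : Real.log n ≤ l := Real.log_le_log (by linarith) hnx
    have hdiv : 1 / (n : ℝ) ≤ 1 := by rw [div_le_one (by linarith)]; exact hn'
    have := h (Real.log n) _ hL b1 (b2.trans hdiv)
    set δ := Real.log (n + 1) - Real.log n with hδ
    rw [show Real.log n + δ = Real.log (n + 1) by rw [hδ]; ring] at this
    have e : (a + 1) * (Real.log n ^ a / n) -
      (Real.log (n + 1) ^ (a + 1) - Real.log n ^ (a + 1)) =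
      -(Real.log (n + 1) ^ (a + 1) - Real.log n ^ (a + 1) - (a + 1) * Real.log n ^ a * δ) +
        (a + 1) * Real.log n ^ a * (1 / n - δ) := by ring
    rw [e]
    refine (abs_add_le _ _).trans ?_
    rw [abs_neg, abs_of_nonneg (mul_nonneg (by positivity) (sub_nonneg.2 b2))]
    have q1 : δ ^ 2 ≤ 1 / (n : ℝ) ^ 2 := by
      have := pow_le_pow_left₀ b1 b2 2
      simpa [div_pow] using this
    calc _ ≤ C * (1 + Real.log n) ^ a * δ ^ 2 + (a + 1) * Real.log n ^ a * (1 / n - δ) := by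
          gcongr
      _ ≤ C * (1 + l) ^ a * (1 / (n : ℝ) ^ 2) + (a + 1) * (1 + l) ^ a * (1 / (n : ℝ) ^ 2) := by
          have : Real.log n ≤ 1 + l := by linarith
          have := sub_nonneg.2 b2
          gcongr
      _ = _ := by ring
  have A : |(a + 1) * (∑ n ∈ Finset.Icc 1 N, Real.log n ^ a / n) -
      Real.log (N + 1) ^ (a + 1)| ≤ (C + (a + 1)) * (1 + l) ^ a * Z := by
    rw [← tele N, Finset.mul_sum, ← Finset.sum_sub_distrib]
    refine (Finset.abs_sum_le_sum_abs _ _).trans ((Finset.sum_le_sum step).trans ?_)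
    rw [← Finset.mul_sum]
    gcongr
    exact hsum.sum_le_tsum _ fun n _ => by positivity
  have B : |Real.log (N + 1) ^ (a + 1) - l ^ (a + 1)| ≤ (a + 1) * 2 ^ a * (1 + l) ^ a := by
    have h1 : l ≤ Real.log (N + 1) := Real.log_le_log (by linarith) hxN.le
    have h2 : Real.log (N + 1) ≤ 1 + l := by
      have : Real.log (N + 1) ≤ Real.log (2 * x) :=
        Real.log_le_log (by positivity) (by linarith)
      rw [Real.log_mul (by norm_num) (by linarith)] at this
      have := Real.log_two_lt_d9
      linarith
    refine (abs_pow_sub_pow_le _ _ _).trans ?_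
    rw [abs_of_nonneg (sub_nonneg.2 h1), abs_of_nonneg hl0, abs_of_nonneg (hl0.trans h1),
      max_eq_left h1]
    push_cast
    have : Real.log (N + 1) ^ a ≤ 2 ^ a * (1 + l) ^ a := by
      rw [← mul_pow]; exact pow_le_pow_left₀ (hl0.trans h1) (by linarith) a
    calc (Real.log (N + 1) - l) * (a + 1) * Real.log (N + 1) ^ (a + 1 - 1)
        ≤ 1 * (a + 1) * (2 ^ a * (1 + l) ^ a) := by
          simp only [Nat.add_sub_cancel]
          have := hl0.trans h1
          gcongr; linarith
      _ = _ := by ring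
  have e : (∑ n ∈ Finset.Icc 1 N, Real.log n ^ a / n) - l ^ (a + 1) / (a + 1) =
      (((a + 1) * (∑ n ∈ Finset.Icc 1 N, Real.log n ^ a / n) - Real.log (N + 1) ^ (a + 1)) +
        (Real.log (N + 1) ^ (a + 1) - l ^ (a + 1))) / (a + 1) := by
    field_simp; ring
  rw [e, abs_div, abs_of_pos (by positivity : (0 : ℝ) < a + 1)]
  refine (div_le_self (abs_nonneg _) (by linarith [(Nat.cast_nonneg a : (0 : ℝ) ≤ a)])).trans ?_
  refine (abs_add_le _ _).trans ((add_le_add A B).trans (le_of_eq (by ring)))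

theorem sum_one_div_le {x : ℝ} (hx : 1 ≤ x) :
    ∑ n ∈ Finset.Icc 1 ⌊x⌋₊, 1 / (n : ℝ) ≤ 1 + Real.log x := by
  have := harmonic_floor_le_one_add_log x hx
  rw [harmonic_eq_sum_Icc] at this
  push_cast at this
  simpa [one_div] using this

/-- The Beta-function value `a! k! / (a + k + 1)!`. -/
noncomputable def betaCoeff (a k : ℕ) : ℝ :=
  (Nat.factorial a : ℝ) * Nat.factorial k / Nat.factorial (a + k + 1)

theorem betaCoeff_succ (a k : ℕ) :
    betaCoeff a (k + 1) = betaCoeff a k - betaCoeff (a + 1) k := by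
  unfold betaCoeff
  rw [show a + (k + 1) + 1 = (a + k + 1) + 1 by ring, show a + 1 + k + 1 = (a + k + 1) + 1 by ring,
    Nat.factorial_succ (a + k + 1), Nat.factorial_succ k, Nat.factorial_succ a]
  have : (Nat.factorial (a + k + 1) : ℝ) ≠ 0 := by positivity
  push_cast
  field_simp
  ring

theorem one_le_div_of_mem_Icc_floor {x : ℝ} {n : ℕ} (hx : 1 ≤ x)
    (hn : n ∈ Finset.Icc 1 ⌊x⌋₊) : 1 ≤ (n : ℝ) ∧ (n : ℝ) ≤ x ∧ 1 ≤ x / n := by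
  obtain ⟨h1, h2⟩ := Finset.mem_Icc.1 hn
  have h1' : (1 : ℝ) ≤ n := by exact_mod_cast h1
  have h2' : (n : ℝ) ≤ x := (Nat.le_floor_iff (by linarith)).1 h2
  exact ⟨h1', h2', (one_le_div (by linarith)).2 h2'⟩

theorem sum_log_pow_mul_log_div_pow_bound (k a : ℕ) :
    ∃ K : ℝ, 0 ≤ K ∧ ∀ x : ℝ, 1 ≤ x →
      |(∑ n ∈ Finset.Icc 1 ⌊x⌋₊, Real.log n ^ a / n * Real.log (x / n) ^ k) -
          betaCoeff a k * Real.log x ^ (a + k + 1)| ≤ K * (1 + Real.log x) ^ (a + k) := by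
  induction k generalizing a with
  | zero =>
    obtain ⟨K, hK, h⟩ := sum_log_pow_div_bound a
    refine ⟨K, hK, fun x hx => ?_⟩
    have : betaCoeff a 0 = 1 / (a + 1) := by
      unfold betaCoeff
      rw [Nat.add_zero, Nat.factorial_succ]
      have : (Nat.factorial a : ℝ) ≠ 0 := by positivity
      push_cast
      field_simp
      simp
    simpa [this, div_eq_inv_mul] using h x hx
  | succ k ih =>
    obtain ⟨K1, hK1, h1⟩ := ih a
    obtain ⟨K2, hK2, h2⟩ := ih (a + 1)
    refine ⟨K1 + K2, by positivity, fun x hx => ?_⟩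
    have hl : 0 ≤ Real.log x := Real.log_nonneg hx
    have e : ∑ n ∈ Finset.Icc 1 ⌊x⌋₊, Real.log n ^ a / n * Real.log (x / n) ^ (k + 1) =
        Real.log x * (∑ n ∈ Finset.Icc 1 ⌊x⌋₊, Real.log n ^ a / n * Real.log (x / n) ^ k) -
          ∑ n ∈ Finset.Icc 1 ⌊x⌋₊, Real.log n ^ (a + 1) / n * Real.log (x / n) ^ k := by
      rw [Finset.mul_sum, ← Finset.sum_sub_distrib]
      refine Finset.sum_congr rfl fun n hn => ?_
      obtain ⟨hn1, -, -⟩ := one_le_div_of_mem_Icc_floor hx hn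
      rw [pow_succ (Real.log (x / n)), Real.log_div (by linarith) (by linarith)]
      ring
    have e2 : ∀ S1 S2 : ℝ, Real.log x * S1 - S2 -
        betaCoeff a (k + 1) * Real.log x ^ (a + (k + 1) + 1) =
        Real.log x * (S1 - betaCoeff a k * Real.log x ^ (a + k + 1)) -
          (S2 - betaCoeff (a + 1) k * Real.log x ^ (a + 1 + k + 1)) := by
      intro S1 S2
      rw [betaCoeff_succ]; ring
    rw [e, e2]
    refine (abs_sub _ _).trans ?_
    rw [abs_mul, abs_of_nonneg hl]
    calc _ ≤ (1 + Real.log x) * (K1 * (1 + Real.log x) ^ (a + k)) +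
          K2 * (1 + Real.log x) ^ (a + 1 + k) :=
          add_le_add (mul_le_mul (by linarith) (h1 x hx) (abs_nonneg _) (by linarith)) (h2 x hx)
      _ = _ := by ring

/-- `F x = c (log x) ^ (k + 1) + O((1 + log x) ^ k)` uniformly for `x ≥ 1`. -/
def LogAsymp (F : ℝ → ℝ) (k : ℕ) (c : ℝ) : Prop :=
  ∃ K : ℝ, 0 ≤ K ∧ ∀ x : ℝ, 1 ≤ x → |F x - c * Real.log x ^ (k + 1)| ≤ K * (1 + Real.log x) ^ k

theorem LogAsymp.const_mul {F : ℝ → ℝ} {k : ℕ} {c : ℝ} (h : LogAsymp F k c) (b : ℝ) :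
    LogAsymp (fun x => b * F x) k (b * c) := by
  obtain ⟨K, hK, h⟩ := h
  refine ⟨|b| * K, by positivity, fun x hx => ?_⟩
  rw [mul_assoc, ← mul_sub, abs_mul, mul_assoc]
  exact mul_le_mul_of_nonneg_left (h x hx) (abs_nonneg b)

theorem LogAsymp.sum {ι : Type*} (s : Finset ι) {F : ι → ℝ → ℝ} {k : ℕ} {c : ι → ℝ}
    (h : ∀ i ∈ s, LogAsymp (F i) k (c i)) :
    LogAsymp (fun x => ∑ i ∈ s, F i x) k (∑ i ∈ s, c i) := by
  classical
  induction s using Finset.induction_on with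
  | empty => exact ⟨0, le_rfl, fun x hx => by simp⟩
  | insert i s hi ih =>
    obtain ⟨K1, hK1, h1⟩ := h i (Finset.mem_insert_self i s)
    obtain ⟨K2, hK2, h2⟩ := ih fun j hj => h j (Finset.mem_insert_of_mem hj)
    refine ⟨K1 + K2, by positivity, fun x hx => ?_⟩
    simp only [Finset.sum_insert hi]
    rw [add_mul, add_sub_add_comm, add_mul]
    exact (abs_add_le _ _).trans (add_le_add (h1 x hx) (h2 x hx))

/-- The logarithmic Dirichlet convolution `x ↦ ∑_{n ≤ x} (log n) ^ a / n * F (x / n)`. -/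
noncomputable def logConv (a : ℕ) (F : ℝ → ℝ) (x : ℝ) : ℝ :=
  ∑ n ∈ Finset.Icc 1 ⌊x⌋₊, Real.log n ^ a / n * F (x / n)

theorem logConv_of_lt_one (a : ℕ) (F : ℝ → ℝ) {x : ℝ} (hx : x < 1) : logConv a F x = 0 := by
  simp [logConv, Nat.floor_eq_zero.2 hx]

theorem logConv_eq_sum (a : ℕ) {F : ℝ → ℝ} (hF : ∀ x < 1, F x = 0) {x : ℝ} {N : ℕ}
    (hx : x < N + 1) :
    logConv a F x = ∑ n ∈ Finset.Icc 1 N, Real.log n ^ a / n * F (x / n) := by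
  unfold logConv
  refine Finset.sum_subset (Finset.Icc_subset_Icc_right ?_) fun n hn hn' => ?_
  · exact Nat.lt_succ_iff.1 (Nat.floor_lt' (Nat.succ_ne_zero N) |>.2 (by push_cast; exact hx))
  · have h1 : 1 ≤ n := (Finset.mem_Icc.1 hn).1
    have h2 : ⌊x⌋₊ < n := by
      by_contra hc
      exact hn' (Finset.mem_Icc.2 ⟨h1, not_lt.1 hc⟩)
    have h3 : x < n := (Nat.floor_lt' (by omega)).1 h2
    rw [hF _ ((div_lt_one (by positivity)).2 h3), mul_zero]

theorem LogAsymp.logConv {F : ℝ → ℝ} {k : ℕ} {c : ℝ} (h : LogAsymp F k c) (a : ℕ) :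
    LogAsymp (logConv a F) (a + k + 1) (c * betaCoeff a (k + 1)) := by
  obtain ⟨K1, hK1, h1⟩ := h
  obtain ⟨K2, hK2, h2⟩ := sum_log_pow_mul_log_div_pow_bound (k + 1) a
  refine ⟨K1 + |c| * K2, by positivity, fun x hx => ?_⟩
  have hl : 0 ≤ Real.log x := Real.log_nonneg hx
  have e : _root_.logConv a F x - c * betaCoeff a (k + 1) * Real.log x ^ (a + k + 1 + 1) =
      (∑ n ∈ Finset.Icc 1 ⌊x⌋₊, Real.log n ^ a / n *
        (F (x / n) - c * Real.log (x / n) ^ (k + 1))) +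
      c * ((∑ n ∈ Finset.Icc 1 ⌊x⌋₊, Real.log n ^ a / n * Real.log (x / n) ^ (k + 1)) -
        betaCoeff a (k + 1) * Real.log x ^ (a + (k + 1) + 1)) := by
    unfold _root_.logConv
    simp only [mul_sub, Finset.sum_sub_distrib, Finset.mul_sum]
    have : ∀ n : ℕ, Real.log n ^ a / n * (c * Real.log (x / n) ^ (k + 1)) =
      c * (Real.log n ^ a / n * Real.log (x / n) ^ (k + 1)) := fun n => by ring
    simp only [this]
    ring
  rw [e]
  refine (abs_add_le _ _).trans ?_
  rw [abs_mul c]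
  have A : |∑ n ∈ Finset.Icc 1 ⌊x⌋₊, Real.log n ^ a / n *
        (F (x / n) - c * Real.log (x / n) ^ (k + 1))| ≤ K1 * (1 + Real.log x) ^ (a + k + 1) := by
    refine (Finset.abs_sum_le_sum_abs _ _).trans ?_
    calc _ ≤ ∑ n ∈ Finset.Icc 1 ⌊x⌋₊, K1 * (1 + Real.log x) ^ (a + k) * (1 / (n : ℝ)) := by
          refine Finset.sum_le_sum fun n hn => ?_
          obtain ⟨hn1, hnx, hq⟩ := one_le_div_of_mem_Icc_floor hx hn
          have hn0 : 0 ≤ Real.log n := Real.log_nonneg hn1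
          have hnl : Real.log n ≤ 1 + Real.log x := by
            have := Real.log_le_log (by linarith) hnx
            linarith
          have hql : Real.log (x / n) ≤ Real.log x :=
            Real.log_le_log (by linarith) (div_le_self (by linarith) hn1)
          have hq0 : 0 ≤ Real.log (x / n) := Real.log_nonneg hq
          rw [abs_mul, abs_of_nonneg (by positivity)]
          calc _ ≤ (1 + Real.log x) ^ a / n * (K1 * (1 + Real.log x) ^ k) := by
                refine mul_le_mul (by gcongr) ((h1 _ hq).trans (by gcongr)) (abs_nonneg _)
                  (by positivity)
            _ = _ := by ring
      _ ≤ K1 * (1 + Real.log x) ^ (a + k) * (1 + Real.log x) := by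
          rw [← Finset.mul_sum]
          exact mul_le_mul_of_nonneg_left (sum_one_div_le hx) (by positivity)
      _ = _ := by ring
  calc _ ≤ K1 * (1 + Real.log x) ^ (a + k + 1) + |c| * (K2 * (1 + Real.log x) ^ (a + (k + 1))) :=
        add_le_add A (mul_le_mul_of_nonneg_left (h2 x hx) (abs_nonneg c))
    _ = _ := by ring

/-- The indicator function of `[1, ∞)`. -/
noncomputable def oneLe (x : ℝ) : ℝ := if 1 ≤ x then 1 else 0

theorem oneLe_of_lt_one {x : ℝ} (hx : x < 1) : oneLe x = 0 := if_neg (not_le.2 hx)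

theorem logAsymp_logConv_oneLe : LogAsymp (logConv 0 oneLe) 0 1 := by
  obtain ⟨K, hK, h⟩ := sum_log_pow_div_bound 0
  refine ⟨K, hK, fun x hx => ?_⟩
  have e : logConv 0 oneLe x = ∑ n ∈ Finset.Icc 1 ⌊x⌋₊, Real.log n ^ 0 / n := by
    refine Finset.sum_congr rfl fun n hn => ?_
    rw [oneLe, if_pos (one_le_div_of_mem_Icc_floor hx hn).2.2, mul_one]
  simpa [e] using h x hx

/-- The sum of `(log g)^a (log u)^b (log v)^c / (g u v h)` over `g u v h ≤ x`. -/
noncomputable def logConvFour (a b c : ℕ) : ℝ → ℝ :=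
  logConv a (logConv b (logConv c (logConv 0 oneLe)))

theorem logAsymp_logConvFour (a b c : ℕ) :
    LogAsymp (logConvFour a b c) (a + b + c + 3)
      ((Nat.factorial a : ℝ) * Nat.factorial b * Nat.factorial c /
        Nat.factorial (a + b + c + 4)) := by
  have h := ((logAsymp_logConv_oneLe.logConv c).logConv b).logConv a
  have e1 : a + (b + (c + 0 + 1) + 1) + 1 = a + b + c + 3 := by ring
  have e2 : 1 * betaCoeff c (0 + 1) * betaCoeff b (c + 0 + 1 + 1) *
      betaCoeff a (b + (c + 0 + 1) + 1 + 1) =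
      (Nat.factorial a : ℝ) * Nat.factorial b * Nat.factorial c /
        Nat.factorial (a + b + c + 4) := by
    unfold betaCoeff
    rw [show c + (0 + 1) + 1 = c + 2 by ring, show c + 0 + 1 + 1 = c + 2 by ring,
      show b + (c + 2) + 1 = b + c + 3 by ring, show b + (c + 0 + 1) + 1 + 1 = b + c + 3 by ring,
      show a + (b + c + 3) + 1 = a + b + c + 4 by ring]
    have h2 : (Nat.factorial (c + 2) : ℝ) ≠ 0 := by positivity
    have h3 : (Nat.factorial (b + c + 3) : ℝ) ≠ 0 := by positivity
    have h4 : (Nat.factorial (a + b + c + 4) : ℝ) ≠ 0 := by positivity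
    simp only [zero_add, Nat.factorial_one, Nat.cast_one]
    field_simp
  rw [e1, e2] at h
  exact h

theorem div_lt_nat_succ {x : ℝ} {N n : ℕ} (hx : x < N + 1) (hn : n ∈ Finset.Icc 1 N) :
    x / n < N + 1 := by
  have h1 : (1 : ℝ) ≤ n := by exact_mod_cast (Finset.mem_Icc.1 hn).1
  rw [div_lt_iff₀ (by linarith)]
  have : (0 : ℝ) ≤ N := Nat.cast_nonneg N
  nlinarith

theorem logConvFour_eq_sum (a b c : ℕ) {x : ℝ} {N : ℕ} (hx : x < N + 1) :
    logConvFour a b c x = ∑ g ∈ Finset.Icc 1 N, ∑ u ∈ Finset.Icc 1 N, ∑ v ∈ Finset.Icc 1 N,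
      ∑ h ∈ Finset.Icc 1 N, Real.log g ^ a * Real.log u ^ b * Real.log v ^ c /
        (g * u * v * h) * oneLe (x / (g * u * v * h)) := by
  unfold logConvFour
  rw [logConv_eq_sum a (fun y hy => logConv_of_lt_one _ _ hy) hx]
  refine Finset.sum_congr rfl fun g hg => ?_
  have hg' := div_lt_nat_succ hx hg
  rw [logConv_eq_sum b (fun y hy => logConv_of_lt_one _ _ hy) hg', Finset.mul_sum]
  refine Finset.sum_congr rfl fun u hu => ?_
  have hu' := div_lt_nat_succ hg' hu
  rw [logConv_eq_sum c (fun y hy => logConv_of_lt_one _ _ hy) hu', Finset.mul_sum, Finset.mul_sum]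
  refine Finset.sum_congr rfl fun v hv => ?_
  have hv' := div_lt_nat_succ hu' hv
  rw [logConv_eq_sum 0 (fun y hy => oneLe_of_lt_one hy) hv', Finset.mul_sum, Finset.mul_sum,
    Finset.mul_sum]
  refine Finset.sum_congr rfl fun h _ => ?_
  rw [div_div, div_div, div_div]
  simp only [div_eq_mul_inv, mul_inv, pow_zero]
  ring_nf

/-- The sum of `(log (g u) + α)^μ (log (g v) + α)^ν / (g u v h)` over `g u v h ≤ x`, with all
variables at most `N`. -/
noncomputable def quadSum (N μ ν : ℕ) (α x : ℝ) : ℝ :=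
  ∑ g ∈ Finset.Icc 1 N, ∑ u ∈ Finset.Icc 1 N, ∑ v ∈ Finset.Icc 1 N, ∑ h ∈ Finset.Icc 1 N,
    (Real.log g + Real.log u + α) ^ μ * (Real.log g + Real.log v + α) ^ ν /
      (g * u * v * h) * oneLe (x / (g * u * v * h))

theorem quadSum_zero_eq (N μ ν : ℕ) {x : ℝ} (hx : x < N + 1) :
    quadSum N μ ν 0 x = ∑ i ∈ Finset.range (μ + 1), ∑ j ∈ Finset.range (ν + 1),
      (μ.choose i : ℝ) * ν.choose j * logConvFour (i + j) (μ - i) (ν - j) x := by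
  simp only [logConvFour_eq_sum _ _ _ hx]
  simp only [Finset.mul_sum]
  have key : ∀ g u v h : ℕ, (Real.log g + Real.log u + 0) ^ μ * (Real.log g + Real.log v + 0) ^ ν /
      (g * u * v * h) * oneLe (x / (g * u * v * h)) =
      ∑ i ∈ Finset.range (μ + 1), ∑ j ∈ Finset.range (ν + 1), (μ.choose i : ℝ) * ν.choose j *
        (Real.log g ^ (i + j) * Real.log u ^ (μ - i) * Real.log v ^ (ν - j) /
        (g * u * v * h) * oneLe (x / (g * u * v * h))) := by
    intro g u v h
    rw [add_zero, add_zero, add_pow, add_pow, Finset.sum_mul_sum, Finset.sum_div, Finset.sum_mul]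
    refine Finset.sum_congr rfl fun i _ => ?_
    rw [Finset.sum_div, Finset.sum_mul]
    refine Finset.sum_congr rfl fun j _ => ?_
    rw [pow_add]
    ring
  unfold quadSum
  simp only [key]
  have comm2 : ∀ f : ℕ → ℕ → ℕ → ℝ, ∑ w ∈ Finset.Icc 1 N, ∑ i ∈ Finset.range (μ + 1),
      ∑ j ∈ Finset.range (ν + 1), f w i j = ∑ i ∈ Finset.range (μ + 1),
      ∑ j ∈ Finset.range (ν + 1), ∑ w ∈ Finset.Icc 1 N, f w i j := by
    intro f
    rw [Finset.sum_comm]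
    exact Finset.sum_congr rfl fun i _ => Finset.sum_comm
  simp only [comm2]

theorem sum_range_sum_range_choose (μ ν : ℕ) :
    (∑ i ∈ Finset.range (μ + 1), ∑ j ∈ Finset.range (ν + 1), (i + j).choose i) + 1 =
      (μ + ν + 2).choose (μ + 1) := by
  have inner : ∀ i, ∑ j ∈ Finset.range (ν + 1), (i + j).choose i = (i + ν + 1).choose (i + 1) := by
    intro i
    induction ν with
    | zero => simp
    | succ n ih =>
      rw [Finset.sum_range_succ, ih, ← add_assoc i n 1, Nat.choose_succ_succ' (i + n + 1) i,
        add_comm]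
  simp only [inner]
  induction μ with
  | zero => simp
  | succ m ih =>
    rw [Finset.sum_range_succ, add_right_comm, ih,
      show m + 1 + ν + 2 = (m + ν + 2) + 1 by ring, Nat.choose_succ_succ' (m + ν + 2) (m + 1),
      show m + 1 + ν + 1 = m + ν + 2 by ring]

theorem sum_choose_mul_factorial_eq_Cconst (μ ν : ℕ) :
    ∑ i ∈ Finset.range (μ + 1), ∑ j ∈ Finset.range (ν + 1), (μ.choose i : ℝ) * ν.choose j *
      ((Nat.factorial (i + j) : ℝ) * Nat.factorial (μ - i) * Nat.factorial (ν - j) /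
        Nat.factorial (μ + ν + 4)) = Cconst μ ν := by
  unfold Cconst
  rw [← sum_range_sum_range_choose μ ν]
  push_cast
  rw [add_sub_cancel_right, Finset.mul_sum]
  refine Finset.sum_congr rfl fun i hi => ?_
  rw [Finset.mul_sum]
  refine Finset.sum_congr rfl fun j hj => ?_
  have hi' : i ≤ μ := by simpa [Nat.lt_succ_iff] using hi
  have hj' : j ≤ ν := by simpa [Nat.lt_succ_iff] using hj
  have h1 : (μ.choose i : ℝ) * Nat.factorial i * Nat.factorial (μ - i) = Nat.factorial μ := by
    exact_mod_cast Nat.choose_mul_factorial_mul_factorial hi'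
  have h2 : (ν.choose j : ℝ) * Nat.factorial j * Nat.factorial (ν - j) = Nat.factorial ν := by
    exact_mod_cast Nat.choose_mul_factorial_mul_factorial hj'
  have h3 : ((i + j).choose i : ℝ) * Nat.factorial i * Nat.factorial j =
      Nat.factorial (i + j) := by
    have := Nat.choose_mul_factorial_mul_factorial (Nat.le_add_right i j)
    rw [Nat.add_sub_cancel_left] at this
    exact_mod_cast this
  rw [← h1, ← h2, ← h3]
  ring

/-- The main term of `quadSum` with `α = 0`, as a function independent of the cutoff `N`. -/
theorem logAsymp_sum_logConvFour (μ ν : ℕ) :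
    LogAsymp (fun x => ∑ i ∈ Finset.range (μ + 1), ∑ j ∈ Finset.range (ν + 1),
      (μ.choose i : ℝ) * ν.choose j * logConvFour (i + j) (μ - i) (ν - j) x)
      (μ + ν + 3) (Cconst μ ν) := by
  rw [← sum_choose_mul_factorial_eq_Cconst]
  refine LogAsymp.sum _ fun i hi => LogAsymp.sum _ fun j hj => ?_
  have hi' : i ≤ μ := by simpa [Nat.lt_succ_iff] using hi
  have hj' : j ≤ ν := by simpa [Nat.lt_succ_iff] using hj
  have := (logAsymp_logConvFour (i + j) (μ - i) (ν - j)).const_mul ((μ.choose i : ℝ) * ν.choose j)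
  rwa [show i + j + (μ - i) + (ν - j) = μ + ν by omega] at this

theorem sum_Icc_ite_dvd_eq {N e : ℕ} (he : 1 ≤ e) (f : ℕ → ℝ) (hf : ∀ m, N < m → f m = 0) :
    ∑ u ∈ Finset.Icc 1 N, (if e ∣ u then f u else 0) = ∑ u ∈ Finset.Icc 1 N, f (e * u) := by
  have h1 : ∑ u ∈ Finset.Icc 1 N, f (e * u) =
      ∑ u ∈ (Finset.Icc 1 N).filter (fun u => e * u ≤ N), f (e * u) := by
    symm
    refine Finset.sum_subset (Finset.filter_subset _ _) fun u hu hu' => hf _ ?_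
    by_contra hc
    exact hu' (Finset.mem_filter.2 ⟨hu, not_lt.1 hc⟩)
  rw [h1, ← Finset.sum_filter]
  refine Finset.sum_nbij' (fun u => u / e) (fun u => e * u) ?_ ?_ ?_ ?_ ?_
  · intro u hu
    obtain ⟨hu, c, rfl⟩ := Finset.mem_filter.1 hu
    rw [Nat.mul_div_cancel_left _ he]
    simp only [Finset.mem_Icc, Finset.mem_filter] at hu ⊢
    have : 1 ≤ c := Nat.pos_of_ne_zero fun h => by simp [h] at hu
    exact ⟨⟨this, (Nat.le_mul_of_pos_left c he).trans hu.2⟩, hu.2⟩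
  · intro u hu
    simp only [Finset.mem_Icc, Finset.mem_filter] at hu ⊢
    exact ⟨⟨Nat.mul_pos he hu.1.1, hu.2⟩, dvd_mul_right _ _⟩
  · intro u hu
    exact Nat.mul_div_cancel' (Finset.mem_filter.1 hu).2
  · intro u _
    exact Nat.mul_div_cancel_left _ he
  · intro u hu
    rw [Nat.mul_div_cancel' (Finset.mem_filter.1 hu).2]

theorem sum_moebius_dvd_eq_ite_coprime {N u v : ℕ} (hu : u ∈ Finset.Icc 1 N) :
    ∑ e ∈ Finset.Icc 1 N, (if e ∣ u then if e ∣ v then (ArithmeticFunction.moebius e : ℝ) else 0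
      else 0) = if Nat.Coprime u v then 1 else 0 := by
  obtain ⟨hu1, huN⟩ := Finset.mem_Icc.1 hu
  have hg : Nat.gcd u v ≠ 0 := (Nat.gcd_pos_of_pos_left v hu1).ne'
  have h1 : ∑ e ∈ (Nat.gcd u v).divisors, ArithmeticFunction.moebius e =
      if Nat.gcd u v = 1 then 1 else 0 := by
    rw [← ArithmeticFunction.coe_mul_zeta_apply, ArithmeticFunction.moebius_mul_coe_zeta,
      ArithmeticFunction.one_apply]
  have h2 : (Nat.gcd u v).divisors =
      (Finset.Icc 1 N).filter (fun e => e ∣ u ∧ e ∣ v) := by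
    ext e
    simp only [Nat.mem_divisors, Finset.mem_filter, Finset.mem_Icc, Nat.dvd_gcd_iff]
    constructor
    · rintro ⟨⟨h, h'⟩, -⟩
      exact ⟨⟨Nat.pos_of_dvd_of_pos h hu1, (Nat.le_of_dvd hu1 h).trans huN⟩, h, h'⟩
    · rintro ⟨-, h⟩
      exact ⟨h, hg⟩
  have h3 : ((∑ e ∈ (Nat.gcd u v).divisors, ArithmeticFunction.moebius e : ℤ) : ℝ) =
      if Nat.Coprime u v then 1 else 0 := by
    rw [h1]
    unfold Nat.Coprime
    split_ifs <;> simp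
  rw [← h3, h2, Finset.sum_filter]
  push_cast
  refine Finset.sum_congr rfl fun e _ => ?_
  by_cases ha : e ∣ u <;> by_cases hb : e ∣ v <;> simp [ha, hb]

/-- Pairs of divisors `(a, c)` of `n` are parametrised by `a = g u`, `c = g v`, `n = g u v h` with
`u`, `v` coprime. -/
theorem sum_sum_divisors_eq_sum_coprime (N : ℕ) (w : ℕ → ℕ → ℕ → ℝ) :
    ∑ n ∈ Finset.Icc 1 N, ∑ a ∈ n.divisors, ∑ c ∈ n.divisors, w a c n =
      ∑ g ∈ Finset.Icc 1 N, ∑ u ∈ Finset.Icc 1 N, ∑ v ∈ Finset.Icc 1 N, ∑ h ∈ Finset.Icc 1 N,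
        if Nat.Coprime u v ∧ g * u * v * h ≤ N then w (g * u) (g * v) (g * u * v * h) else 0 := by
  have hL : ∑ n ∈ Finset.Icc 1 N, ∑ a ∈ n.divisors, ∑ c ∈ n.divisors, w a c n =
      ∑ x ∈ (Finset.Icc 1 N).sigma (fun n => n.divisors ×ˢ n.divisors),
        w x.2.1 x.2.2 x.1 := by
    rw [Finset.sum_sigma]
    exact Finset.sum_congr rfl fun n _ => by rw [Finset.sum_product]
  have hR : (∑ g ∈ Finset.Icc 1 N, ∑ u ∈ Finset.Icc 1 N, ∑ v ∈ Finset.Icc 1 N,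
      ∑ h ∈ Finset.Icc 1 N, if Nat.Coprime u v ∧ g * u * v * h ≤ N then
        w (g * u) (g * v) (g * u * v * h) else 0) =
      ∑ y ∈ (Finset.Icc 1 N ×ˢ Finset.Icc 1 N ×ˢ Finset.Icc 1 N ×ˢ Finset.Icc 1 N).filter
        (fun y : ℕ × ℕ × ℕ × ℕ => Nat.Coprime y.2.1 y.2.2.1 ∧ y.1 * y.2.1 * y.2.2.1 * y.2.2.2 ≤ N),
        w (y.1 * y.2.1) (y.1 * y.2.2.1) (y.1 * y.2.1 * y.2.2.1 * y.2.2.2) := by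
    rw [Finset.sum_filter, Finset.sum_product]
    refine Finset.sum_congr rfl fun g _ => ?_
    rw [Finset.sum_product]
    refine Finset.sum_congr rfl fun u _ => ?_
    rw [Finset.sum_product]
  rw [hL, hR]
  have recover : ∀ n a c : ℕ, 1 ≤ n → a ∣ n → c ∣ n →
      1 ≤ a.gcd c ∧ 1 ≤ a / a.gcd c ∧ 1 ≤ c / a.gcd c ∧ 1 ≤ n / a.lcm c ∧
      a.gcd c * (a / a.gcd c) = a ∧ a.gcd c * (c / a.gcd c) = c ∧
      a.gcd c * (a / a.gcd c) * (c / a.gcd c) * (n / a.lcm c) = n ∧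
      Nat.Coprime (a / a.gcd c) (c / a.gcd c) := by
    intro n a c hn ha hc
    have ha0 : 0 < a := Nat.pos_of_dvd_of_pos ha hn
    have hc0 : 0 < c := Nat.pos_of_dvd_of_pos hc hn
    have hg : 0 < a.gcd c := Nat.gcd_pos_of_pos_left c ha0
    have ea : a.gcd c * (a / a.gcd c) = a := Nat.mul_div_cancel' (Nat.gcd_dvd_left a c)
    have ec : a.gcd c * (c / a.gcd c) = c := Nat.mul_div_cancel' (Nat.gcd_dvd_right a c)
    have el : a.lcm c = a * (c / a.gcd c) := by
      rw [Nat.lcm, Nat.mul_div_assoc _ (Nat.gcd_dvd_right a c)]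
    have hl : a.lcm c ∣ n := Nat.lcm_dvd ha hc
    have en : a.gcd c * (a / a.gcd c) * (c / a.gcd c) * (n / a.lcm c) = n := by
      rw [ea, ← el]; exact Nat.mul_div_cancel' hl
    refine ⟨hg, ?_, ?_, ?_, ea, ec, en, Nat.coprime_div_gcd_div_gcd hg⟩
    · exact Nat.div_pos (Nat.le_of_dvd ha0 (Nat.gcd_dvd_left a c)) hg
    · exact Nat.div_pos (Nat.le_of_dvd hc0 (Nat.gcd_dvd_right a c)) hg
    · exact Nat.div_pos (Nat.le_of_dvd hn hl) (Nat.lcm_pos ha0 hc0)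
  have memL : ∀ x : (_ : ℕ) × ℕ × ℕ,
      x ∈ (Finset.Icc 1 N).sigma (fun n => n.divisors ×ˢ n.divisors) ↔
        1 ≤ x.1 ∧ x.1 ≤ N ∧ x.2.1 ∣ x.1 ∧ x.2.2 ∣ x.1 := by
    intro x
    simp only [Finset.mem_sigma, Finset.mem_Icc, Finset.mem_product, Nat.mem_divisors]
    constructor
    · rintro ⟨⟨h1, h2⟩, ⟨h3, -⟩, h4, -⟩; exact ⟨h1, h2, h3, h4⟩
    · rintro ⟨h1, h2, h3, h4⟩; exact ⟨⟨h1, h2⟩, ⟨h3, by omega⟩, h4, by omega⟩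
  refine Finset.sum_bij' (fun x _ => (x.2.1.gcd x.2.2, x.2.1 / x.2.1.gcd x.2.2,
    x.2.2 / x.2.1.gcd x.2.2, x.1 / x.2.1.lcm x.2.2))
    (fun y _ => ⟨y.1 * y.2.1 * y.2.2.1 * y.2.2.2, y.1 * y.2.1, y.1 * y.2.2.1⟩) ?_ ?_ ?_ ?_ ?_
  · rintro ⟨n, a, c⟩ hx
    obtain ⟨h1, h2, h3, h4⟩ := (memL _).1 hx
    obtain ⟨r1, r2, r3, r4, -, -, r7, r8⟩ := recover n a c h1 h3 h4
    simp only [Finset.mem_filter, Finset.mem_product, Finset.mem_Icc]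
    have hle : ∀ m, m ∣ n → m ≤ N := fun m hm => (Nat.le_of_dvd h1 hm).trans h2
    refine ⟨⟨⟨r1, hle _ ((Nat.gcd_dvd_left a c).trans h3)⟩,
      ⟨r2, hle _ ((Nat.div_dvd_of_dvd (Nat.gcd_dvd_left a c)).trans h3)⟩,
      ⟨r3, hle _ ((Nat.div_dvd_of_dvd (Nat.gcd_dvd_right a c)).trans h4)⟩,
      ⟨r4, hle _ (Nat.div_dvd_of_dvd (Nat.lcm_dvd h3 h4))⟩⟩, r8, ?_⟩
    rw [r7]; exact h2
  · rintro ⟨g, u, v, h⟩ hy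
    simp only [Finset.mem_filter, Finset.mem_product, Finset.mem_Icc] at hy
    obtain ⟨⟨⟨g1, -⟩, ⟨u1, -⟩, ⟨v1, -⟩, ⟨h1, -⟩⟩, -, hN⟩ := hy
    refine (memL _).2 ⟨?_, hN, ⟨v * h, by ring⟩, ⟨u * h, by ring⟩⟩
    exact Nat.mul_pos (Nat.mul_pos (Nat.mul_pos g1 u1) v1) h1
  · rintro ⟨n, a, c⟩ hx
    obtain ⟨h1, -, h3, h4⟩ := (memL _).1 hx
    obtain ⟨-, -, -, -, r5, r6, r7, -⟩ := recover n a c h1 h3 h4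
    simp only [r5, r6]
    rw [r5] at r7
    simp only [r7]
  · rintro ⟨g, u, v, h⟩ hy
    simp only [Finset.mem_filter, Finset.mem_product, Finset.mem_Icc] at hy
    obtain ⟨⟨⟨g1, -⟩, ⟨u1, -⟩, ⟨v1, -⟩, ⟨h1, -⟩⟩, hco, hN⟩ := hy
    have eg : Nat.gcd (g * u) (g * v) = g := by
      rw [Nat.gcd_mul_left, hco.gcd_eq_one, mul_one]
    have el : Nat.lcm (g * u) (g * v) = g * u * v := by
      rw [Nat.lcm_mul_left, hco.lcm_eq_mul, mul_assoc]
    simp only [eg, el]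
    rw [Nat.mul_div_cancel_left _ g1, Nat.mul_div_cancel_left _ g1,
      Nat.mul_div_cancel_left _ (Nat.mul_pos (Nat.mul_pos g1 u1) v1)]
  · rintro ⟨n, a, c⟩ hx
    obtain ⟨h1, -, h3, h4⟩ := (memL _).1 hx
    obtain ⟨-, -, -, -, r5, r6, r7, -⟩ := recover n a c h1 h3 h4
    simp only [r7]
    simp only [r5, r6]

theorem dLog_eq_sum_divisors (μ n : ℕ) : dLog μ n = ∑ a ∈ n.divisors, Real.log a ^ μ := by
  unfold dLog dGen
  simp only [pow_zero, mul_one]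
  exact Nat.sum_divisorsAntidiagonal (fun a _ => Real.log a ^ μ)

/-- The sum of `d^{(μ)}(n) d^{(ν)}(n) / n` over `n ≤ t`. -/
noncomputable def sumDLogMulDLog (μ ν : ℕ) (t : ℝ) : ℝ :=
  ∑ n ∈ Finset.Icc 1 ⌊t⌋₊, dLog μ n * dLog ν n / n

theorem sumDLogMulDLog_eq_sum_moebius (μ ν : ℕ) {t : ℝ} (ht : 1 ≤ t) :
    sumDLogMulDLog μ ν t = ∑ e ∈ Finset.Icc 1 ⌊t⌋₊, (ArithmeticFunction.moebius e : ℝ) / e ^ 2 *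
      quadSum ⌊t⌋₊ μ ν (Real.log e) (t / e ^ 2) := by
  set N := ⌊t⌋₊ with hN
  set T : ℕ → ℕ → ℕ → ℕ → ℝ := fun g u v h =>
    (Real.log g + Real.log u) ^ μ * (Real.log g + Real.log v) ^ ν / (g * u * v * h) *
      oneLe (t / (g * u * v * h)) with hT
  have hcond : ∀ g u v h : ℕ, 1 ≤ g * u * v * h →
      oneLe (t / (g * u * v * h)) = if g * u * v * h ≤ N then 1 else 0 := by
    intro g u v h h1
    have h1' : (1 : ℝ) ≤ g * u * v * h := by exact_mod_cast h1
    unfold oneLe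
    have : (1 ≤ t / ((g : ℝ) * u * v * h)) ↔ g * u * v * h ≤ N := by
      rw [one_le_div (by linarith), hN, Nat.le_floor_iff (by linarith)]
      push_cast; rfl
    simp only [this]
  have hTzero : ∀ g u v h : ℕ, 1 ≤ g → 1 ≤ u → 1 ≤ v → 1 ≤ h → N < g * u * v * h →
      T g u v h = 0 := by
    intro g u v h hg hu hv hh hlt
    simp only [hT]
    rw [hcond _ _ _ _ (Nat.mul_pos (Nat.mul_pos (Nat.mul_pos hg hu) hv) hh),
      if_neg (not_le.2 hlt), mul_zero]
  have s1 : sumDLogMulDLog μ ν t = ∑ g ∈ Finset.Icc 1 N, ∑ u ∈ Finset.Icc 1 N,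
      ∑ v ∈ Finset.Icc 1 N, ∑ h ∈ Finset.Icc 1 N,
        (if Nat.Coprime u v then 1 else 0) * T g u v h := by
    have : sumDLogMulDLog μ ν t = ∑ n ∈ Finset.Icc 1 N, ∑ a ∈ n.divisors, ∑ c ∈ n.divisors,
        Real.log a ^ μ * Real.log c ^ ν / n := by
      unfold sumDLogMulDLog
      refine Finset.sum_congr rfl fun n _ => ?_
      rw [dLog_eq_sum_divisors, dLog_eq_sum_divisors, Finset.sum_mul_sum, Finset.sum_div]
      exact Finset.sum_congr rfl fun a _ => Finset.sum_div _ _ _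
    rw [this, sum_sum_divisors_eq_sum_coprime N
      (fun a c n => Real.log a ^ μ * Real.log c ^ ν / n)]
    refine Finset.sum_congr rfl fun g hg => Finset.sum_congr rfl fun u hu =>
      Finset.sum_congr rfl fun v hv => Finset.sum_congr rfl fun h hh => ?_
    have hg := (Finset.mem_Icc.1 hg).1
    have hu := (Finset.mem_Icc.1 hu).1
    have hv := (Finset.mem_Icc.1 hv).1
    have hh := (Finset.mem_Icc.1 hh).1
    simp only [hT]
    rw [hcond _ _ _ _ (Nat.mul_pos (Nat.mul_pos (Nat.mul_pos hg hu) hv) hh)]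
    push_cast
    rw [Real.log_mul (by positivity) (by positivity), Real.log_mul (by positivity) (by positivity)]
    by_cases c1 : Nat.Coprime u v <;> by_cases c2 : g * u * v * h ≤ N <;> simp [c1, c2]
  have s2 : ∀ g u v h : ℕ, u ∈ Finset.Icc 1 N →
      (if Nat.Coprime u v then 1 else 0) * T g u v h =
      ∑ e ∈ Finset.Icc 1 N, (ArithmeticFunction.moebius e : ℝ) *
        (if e ∣ u then if e ∣ v then T g u v h else 0 else 0) := by
    intro g u v h hu
    rw [← sum_moebius_dvd_eq_ite_coprime hu, Finset.sum_mul]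
    refine Finset.sum_congr rfl fun e _ => ?_
    split_ifs <;> simp
  have s3 : sumDLogMulDLog μ ν t = ∑ e ∈ Finset.Icc 1 N, ∑ g ∈ Finset.Icc 1 N,
      ∑ u ∈ Finset.Icc 1 N, ∑ v ∈ Finset.Icc 1 N, ∑ h ∈ Finset.Icc 1 N,
        (ArithmeticFunction.moebius e : ℝ) *
          (if e ∣ u then if e ∣ v then T g u v h else 0 else 0) := by
    rw [s1]
    symm
    conv_lhs => rw [Finset.sum_comm]
    refine Finset.sum_congr rfl fun g _ => ?_
    conv_lhs => rw [Finset.sum_comm]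
    refine Finset.sum_congr rfl fun u hu => ?_
    conv_lhs => rw [Finset.sum_comm]
    refine Finset.sum_congr rfl fun v _ => ?_
    conv_lhs => rw [Finset.sum_comm]
    exact Finset.sum_congr rfl fun h _ => (s2 g u v h hu).symm
  rw [s3]
  refine Finset.sum_congr rfl fun e he => ?_
  have he1 : 1 ≤ e := (Finset.mem_Icc.1 he).1
  have he0 : (e : ℝ) ≠ 0 := by positivity
  simp only [quadSum, Finset.mul_sum]
  refine Finset.sum_congr rfl fun g hg => ?_
  have hg := (Finset.mem_Icc.1 hg).1
  have r1 : ∀ u ∈ Finset.Icc 1 N, (∑ v ∈ Finset.Icc 1 N, ∑ h ∈ Finset.Icc 1 N,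
      (ArithmeticFunction.moebius e : ℝ) *
          (if e ∣ u then if e ∣ v then T g u v h else 0 else 0)) =
      if e ∣ u then (∑ v ∈ Finset.Icc 1 N, ∑ h ∈ Finset.Icc 1 N,
        (ArithmeticFunction.moebius e : ℝ) * T g u (e * v) h) else 0 := by
    intro u hu
    have hu := (Finset.mem_Icc.1 hu).1
    split_ifs with hd
    · rw [← sum_Icc_ite_dvd_eq he1 (fun v => ∑ h ∈ Finset.Icc 1 N,
        (ArithmeticFunction.moebius e : ℝ) * T g u v h)]
      · refine Finset.sum_congr rfl fun v _ => ?_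
        split_ifs <;> simp
      · intro v hv
        refine Finset.sum_eq_zero fun h hh => ?_
        have hh := (Finset.mem_Icc.1 hh).1
        rw [hTzero g u v h hg hu (by omega) hh, mul_zero]
        calc N < v := hv
          _ = 1 * 1 * v * 1 := by ring
          _ ≤ g * u * v * h := by gcongr
    · simp
  rw [Finset.sum_congr rfl r1, sum_Icc_ite_dvd_eq he1 (fun u => ∑ v ∈ Finset.Icc 1 N,
    ∑ h ∈ Finset.Icc 1 N, (ArithmeticFunction.moebius e : ℝ) * T g u (e * v) h)]
  · refine Finset.sum_congr rfl fun u hu => Finset.sum_congr rfl fun v hv =>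
      Finset.sum_congr rfl fun h hh => ?_
    have hu := (Finset.mem_Icc.1 hu).1
    have hv := (Finset.mem_Icc.1 hv).1
    have hh := (Finset.mem_Icc.1 hh).1
    have e1 : t / ((g : ℝ) * (e * u) * (e * v) * h) = t / e ^ 2 / (g * u * v * h) := by
      rw [div_div]; congr 1; ring
    simp only [hT]
    push_cast
    rw [Real.log_mul (by positivity) (by positivity), Real.log_mul (by positivity) (by positivity),
      e1]
    have e2 : Real.log g + (Real.log e + Real.log u) = Real.log g + Real.log u + Real.log e := by
      ring
    have e3 : Real.log g + (Real.log e + Real.log v) = Real.log g + Real.log v + Real.log e := by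
      ring
    rw [e2, e3]
    have : (g : ℝ) ≠ 0 := by positivity
    have : (u : ℝ) ≠ 0 := by positivity
    have : (v : ℝ) ≠ 0 := by positivity
    have : (h : ℝ) ≠ 0 := by positivity
    field_simp
  · intro u hu
    refine Finset.sum_eq_zero fun v hv => Finset.sum_eq_zero fun h hh => ?_
    have hv := (Finset.mem_Icc.1 hv).1
    have hh := (Finset.mem_Icc.1 hh).1
    have hev : 1 ≤ e * v := Nat.mul_pos he1 hv
    rw [hTzero g u (e * v) h hg (by omega) hev hh, mul_zero]
    calc N < u := hu
      _ = 1 * u * 1 * 1 := by ring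
      _ ≤ g * u * (e * v) * h := by gcongr

theorem hasSum_moebius_div_sq :
    HasSum (fun e : ℕ => (ArithmeticFunction.moebius e : ℝ) / (e : ℝ) ^ 2) (6 / Real.pi ^ 2) := by
  have h2 : 1 < (2 : ℂ).re := by norm_num
  have hs := (ArithmeticFunction.LSeriesSummable_moebius_iff.2 h2).LSeriesHasSum
  have hv := LSeries_one_mul_Lseries_moebius h2
  rw [LSeries_one_eq_riemannZeta h2, riemannZeta_two] at hv
  have hpi : (Real.pi : ℂ) ≠ 0 := by exact_mod_cast Real.pi_ne_zero
  have hv' : LSeries (fun n => ((ArithmeticFunction.moebius n : ℤ) : ℂ)) 2 =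
      ((6 / Real.pi ^ 2 : ℝ) : ℂ) := by
    push_cast
    rw [eq_div_iff (by positivity)]
    field_simp at hv
    linear_combination hv
  rw [hv'] at hs
  have hs' : HasSum (LSeries.term (fun n => ((ArithmeticFunction.moebius n : ℤ) : ℂ)) 2)
      ((6 / Real.pi ^ 2 : ℝ) : ℂ) := hs
  rw [← Complex.hasSum_ofReal]
  convert hs' using 1
  funext e
  rcases eq_or_ne e 0 with rfl | he
  · simp
  · rw [LSeries.term_of_ne_zero he]
    push_cast
    norm_num

theorem summable_one_add_log_div_sq :
    Summable (fun e : ℕ => (1 + Real.log e) / (e : ℝ) ^ 2) := by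
  have h1 : Summable (fun e : ℕ => 1 / (e : ℝ) ^ 2 + 2 * (1 / (e : ℝ) ^ (3 / 2 : ℝ))) :=
    (Real.summable_one_div_nat_pow.2 one_lt_two).add
      ((Real.summable_one_div_nat_rpow.2 (by norm_num)).mul_left 2)
  refine Summable.of_nonneg_of_le (fun e => ?_) (fun e => ?_) h1
  · have := Real.log_natCast_nonneg e
    positivity
  · rcases Nat.eq_zero_or_pos e with rfl | he
    · simp
    have he' : (0 : ℝ) < e := by exact_mod_cast he
    rw [add_div]
    have h3 := Real.log_le_rpow_div he'.le (by norm_num : (0 : ℝ) < 1 / 2)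
    have h4 : (e : ℝ) ^ (1 / 2 : ℝ) / (e : ℝ) ^ 2 = 1 / (e : ℝ) ^ (3 / 2 : ℝ) := by
      rw [div_eq_div_iff (by positivity) (by positivity), one_mul, ← Real.rpow_add he',
        ← Real.rpow_natCast]
      norm_num
    have h5 : Real.log e / (e : ℝ) ^ 2 ≤ 2 * (1 / (e : ℝ) ^ (3 / 2 : ℝ)) := by
      rw [← h4]
      calc Real.log e / (e : ℝ) ^ 2 ≤ ((e : ℝ) ^ (1 / 2 : ℝ) / (1 / 2)) / (e : ℝ) ^ 2 := by gcongr
        _ = _ := by ring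
    linarith

theorem mul_abs_add_pow_sub_pow_le (n : ℕ) {A α y : ℝ} (hA : 0 ≤ A) (hα : 0 ≤ α)
    (hy : A + α ≤ y) : y * |(A + α) ^ n - A ^ n| ≤ n * α * y ^ n := by
  have hy0 : 0 ≤ y := by linarith
  cases n with
  | zero => simp
  | succ n =>
    have h := abs_pow_sub_pow_le (A + α) A (n + 1)
    rw [abs_of_nonneg hA, abs_of_nonneg (by linarith : 0 ≤ A + α), max_eq_left (by linarith),
      Nat.add_sub_cancel, add_sub_cancel_left, abs_of_nonneg hα] at h
    calc y * |(A + α) ^ (n + 1) - A ^ (n + 1)| ≤ y * (α * (n + 1 : ℕ) * (A + α) ^ n) := by gcongr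
      _ ≤ y * (α * (n + 1 : ℕ) * y ^ n) := by gcongr
      _ = _ := by ring

theorem mul_abs_pow_mul_pow_sub_le (μ ν : ℕ) {A B α y : ℝ} (hA : 0 ≤ A) (hB : 0 ≤ B)
    (hα : 0 ≤ α) (hAy : A + α ≤ y) (hBy : B + α ≤ y) :
    y * |(A + α) ^ μ * (B + α) ^ ν - A ^ μ * B ^ ν| ≤ (μ + ν) * α * y ^ (μ + ν) := by
  have hy0 : 0 ≤ y := by linarith
  have e : (A + α) ^ μ * (B + α) ^ ν - A ^ μ * B ^ ν =
      ((A + α) ^ μ - A ^ μ) * (B + α) ^ ν + A ^ μ * ((B + α) ^ ν - B ^ ν) := by ring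
  rw [e]
  have h1 := mul_abs_add_pow_sub_pow_le μ hA hα hAy
  have h2 := mul_abs_add_pow_sub_pow_le ν hB hα hBy
  have h3 : (B + α) ^ ν ≤ y ^ ν := by gcongr
  have h4 : A ^ μ ≤ y ^ μ := by gcongr; linarith
  calc _ ≤ y * (|((A + α) ^ μ - A ^ μ) * (B + α) ^ ν| + |A ^ μ * ((B + α) ^ ν - B ^ ν)|) := by
        gcongr; exact abs_add_le _ _
    _ = (y * |(A + α) ^ μ - A ^ μ|) * (B + α) ^ ν + (y * |(B + α) ^ ν - B ^ ν|) * A ^ μ := by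
        rw [abs_mul, abs_mul, abs_of_nonneg (by positivity : 0 ≤ (B + α) ^ ν),
          abs_of_nonneg (by positivity : 0 ≤ A ^ μ)]
        ring
    _ ≤ (μ * α * y ^ μ) * y ^ ν + (ν * α * y ^ ν) * y ^ μ := by gcongr
    _ = _ := by ring

theorem sum_four_one_div_le {t : ℝ} (ht : 1 ≤ t) :
    ∑ g ∈ Finset.Icc 1 ⌊t⌋₊, ∑ u ∈ Finset.Icc 1 ⌊t⌋₊, ∑ v ∈ Finset.Icc 1 ⌊t⌋₊,
      ∑ h ∈ Finset.Icc 1 ⌊t⌋₊, 1 / ((g : ℝ) * u * v * h) ≤ (1 + Real.log t) ^ 4 := by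
  have e : ∑ g ∈ Finset.Icc 1 ⌊t⌋₊, ∑ u ∈ Finset.Icc 1 ⌊t⌋₊, ∑ v ∈ Finset.Icc 1 ⌊t⌋₊,
      ∑ h ∈ Finset.Icc 1 ⌊t⌋₊, 1 / ((g : ℝ) * u * v * h) =
      (∑ n ∈ Finset.Icc 1 ⌊t⌋₊, 1 / (n : ℝ)) ^ 4 := by
    have : ∀ g u v h : ℕ, 1 / ((g : ℝ) * u * v * h) = 1 / g * (1 / u * (1 / v * (1 / h))) := by
      intro g u v h
      simp only [one_div, mul_inv]; ring
    simp only [this, ← Finset.mul_sum, ← Finset.sum_mul]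
    ring
  rw [e]
  exact pow_le_pow_left₀ (Finset.sum_nonneg fun n _ => by positivity) (sum_one_div_le ht) 4

theorem abs_quadSum_sub_quadSum_zero_le (μ ν : ℕ) {t : ℝ} (ht : 1 ≤ t) {e : ℕ} (he : 1 ≤ e) :
    |quadSum ⌊t⌋₊ μ ν (Real.log e) (t / e ^ 2) - quadSum ⌊t⌋₊ μ ν 0 (t / e ^ 2)| ≤
      (μ + ν) * Real.log e * (1 + Real.log t) ^ (μ + ν + 3) := by
  have hl : 0 ≤ Real.log t := Real.log_nonneg ht
  have hy : 0 < 1 + Real.log t := by linarith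
  have he' : (1 : ℝ) ≤ e := by exact_mod_cast he
  have hα : 0 ≤ Real.log e := Real.log_nonneg he'
  refine le_of_mul_le_mul_left ?_ hy
  have hterm : ∀ g ∈ Finset.Icc 1 ⌊t⌋₊, ∀ u ∈ Finset.Icc 1 ⌊t⌋₊, ∀ v ∈ Finset.Icc 1 ⌊t⌋₊,
      ∀ h ∈ Finset.Icc 1 ⌊t⌋₊,
      (1 + Real.log t) * |(Real.log g + Real.log u + Real.log e) ^ μ *
        (Real.log g + Real.log v + Real.log e) ^ ν / ((g : ℝ) * u * v * h) *
          oneLe (t / e ^ 2 / (g * u * v * h)) -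
        (Real.log g + Real.log u + 0) ^ μ * (Real.log g + Real.log v + 0) ^ ν /
          (g * u * v * h) * oneLe (t / e ^ 2 / (g * u * v * h))| ≤
      (μ + ν) * Real.log e * (1 + Real.log t) ^ (μ + ν) * (1 / ((g : ℝ) * u * v * h)) := by
    intro g hg u hu v hv h hh
    have hg : (1 : ℝ) ≤ g := by exact_mod_cast (Finset.mem_Icc.1 hg).1
    have hu : (1 : ℝ) ≤ u := by exact_mod_cast (Finset.mem_Icc.1 hu).1
    have hv : (1 : ℝ) ≤ v := by exact_mod_cast (Finset.mem_Icc.1 hv).1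
    have hh : (1 : ℝ) ≤ h := by exact_mod_cast (Finset.mem_Icc.1 hh).1
    have hg0 := Real.log_nonneg hg
    have hu0 := Real.log_nonneg hu
    have hv0 := Real.log_nonneg hv
    have hpos : (0 : ℝ) < g * u * v * h := by positivity
    by_cases hc : 1 ≤ t / e ^ 2 / ((g : ℝ) * u * v * h)
    · rw [oneLe, if_pos hc, mul_one, mul_one, add_zero, add_zero, ← sub_div, abs_div,
        abs_of_pos hpos, ← mul_div_assoc, div_eq_mul_one_div]
      refine mul_le_mul_of_nonneg_right ?_ (by positivity)
      rw [div_div, one_le_div (by positivity)] at hc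
      have hbound : ∀ w : ℝ, 1 ≤ w → g * w * e ≤ (e : ℝ) ^ 2 * (g * u * v * h) →
          Real.log g + Real.log w + Real.log e ≤ 1 + Real.log t := by
        intro w hw hle
        rw [← Real.log_mul (by positivity) (by positivity),
          ← Real.log_mul (by positivity) (by positivity)]
        have := Real.log_le_log (by positivity) (hle.trans hc)
        linarith
      refine mul_abs_pow_mul_pow_sub_le μ ν (by positivity) (by positivity) hα
        (hbound u hu ?_) (hbound v hv ?_)
      · calc (g : ℝ) * u * e = (e * 1) * (g * u * 1 * 1) := by ring
          _ ≤ (e * e) * (g * u * v * h) := by gcongr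
          _ = _ := by ring
      · calc (g : ℝ) * v * e = (e * 1) * (g * 1 * v * 1) := by ring
          _ ≤ (e * e) * (g * u * v * h) := by gcongr
          _ = _ := by ring
    · rw [oneLe, if_neg hc, mul_zero, mul_zero, sub_zero, abs_zero, mul_zero]
      positivity
  unfold quadSum
  simp only [← Finset.sum_sub_distrib]
  calc _ ≤ (1 + Real.log t) * ∑ g ∈ Finset.Icc 1 ⌊t⌋₊, ∑ u ∈ Finset.Icc 1 ⌊t⌋₊,
        ∑ v ∈ Finset.Icc 1 ⌊t⌋₊, ∑ h ∈ Finset.Icc 1 ⌊t⌋₊,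
        |(Real.log g + Real.log u + Real.log e) ^ μ *
        (Real.log g + Real.log v + Real.log e) ^ ν / ((g : ℝ) * u * v * h) *
          oneLe (t / e ^ 2 / (g * u * v * h)) -
        (Real.log g + Real.log u + 0) ^ μ * (Real.log g + Real.log v + 0) ^ ν /
          (g * u * v * h) * oneLe (t / e ^ 2 / (g * u * v * h))| := by
        refine mul_le_mul_of_nonneg_left ?_ hy.le
        refine (Finset.abs_sum_le_sum_abs _ _).trans (Finset.sum_le_sum fun g _ => ?_)
        refine (Finset.abs_sum_le_sum_abs _ _).trans (Finset.sum_le_sum fun u _ => ?_)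
        refine (Finset.abs_sum_le_sum_abs _ _).trans (Finset.sum_le_sum fun v _ => ?_)
        exact Finset.abs_sum_le_sum_abs _ _
    _ ≤ ∑ g ∈ Finset.Icc 1 ⌊t⌋₊, ∑ u ∈ Finset.Icc 1 ⌊t⌋₊, ∑ v ∈ Finset.Icc 1 ⌊t⌋₊,
        ∑ h ∈ Finset.Icc 1 ⌊t⌋₊, (μ + ν) * Real.log e * (1 + Real.log t) ^ (μ + ν) *
          (1 / ((g : ℝ) * u * v * h)) := by
        simp only [Finset.mul_sum]
        exact Finset.sum_le_sum fun g hg => Finset.sum_le_sum fun u hu =>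
          Finset.sum_le_sum fun v hv => Finset.sum_le_sum fun h hh => hterm g hg u hu v hv h hh
    _ ≤ (μ + ν) * Real.log e * (1 + Real.log t) ^ (μ + ν) * (1 + Real.log t) ^ 4 := by
        simp only [← Finset.mul_sum]
        exact mul_le_mul_of_nonneg_left (sum_four_one_div_le ht) (by positivity)
    _ = _ := by ring

theorem quadSum_of_lt_one (N μ ν : ℕ) (α : ℝ) {x : ℝ} (hx : x < 1) : quadSum N μ ν α x = 0 := by
  unfold quadSum
  refine Finset.sum_eq_zero fun g hg => Finset.sum_eq_zero fun u hu =>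
    Finset.sum_eq_zero fun v hv => Finset.sum_eq_zero fun h hh => ?_
  have hpos : 1 ≤ g * u * v * h := Nat.mul_pos (Nat.mul_pos (Nat.mul_pos (Finset.mem_Icc.1 hg).1
    (Finset.mem_Icc.1 hu).1) (Finset.mem_Icc.1 hv).1) (Finset.mem_Icc.1 hh).1
  have hpos' : (1 : ℝ) ≤ g * u * v * h := by exact_mod_cast hpos
  rw [oneLe_of_lt_one, mul_zero]
  rw [div_lt_one (by linarith)]
  linarith

theorem exists_abs_quadSum_sub_le (μ ν : ℕ) : ∃ K : ℝ, 0 ≤ K ∧ ∀ t : ℝ, 1 ≤ t → ∀ e : ℕ, 1 ≤ e →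
    |quadSum ⌊t⌋₊ μ ν (Real.log e) (t / e ^ 2) - Cconst μ ν * Real.log t ^ (μ + ν + 4)| ≤
      K * (1 + Real.log t) ^ (μ + ν + 3) * (1 + Real.log e) := by
  obtain ⟨K, hK, h⟩ := logAsymp_sum_logConvFour μ ν
  set M : ℕ := μ + ν with hM
  have hM0 : (0 : ℝ) ≤ M := Nat.cast_nonneg M
  refine ⟨(M + 4) + K + |Cconst μ ν| * (2 * (M + 4)), by positivity, fun t ht e he => ?_⟩
  set l := Real.log t with hl
  have hl0 : 0 ≤ l := Real.log_nonneg ht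
  have he' : (1 : ℝ) ≤ e := by exact_mod_cast he
  set α := Real.log e with hα
  have hα0 : 0 ≤ α := Real.log_nonneg he'
  have hR : 0 ≤ (1 + l) ^ (M + 3) := by positivity
  have hlR : l ^ (M + 3) ≤ (1 + l) ^ (M + 3) := by gcongr; linarith
  have hlogx : Real.log (t / e ^ 2) = l - 2 * α := by
    rw [Real.log_div (by linarith) (by positivity), Real.log_pow]
    push_cast; rfl
  rcases lt_or_ge (t / (e : ℝ) ^ 2) 1 with hx | hx
  · rw [quadSum_of_lt_one _ _ _ _ hx, zero_sub, abs_neg, abs_mul,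
      abs_of_nonneg (by positivity : 0 ≤ l ^ (M + 4))]
    have h1 : l ≤ 2 * α := by
      have := Real.log_nonpos (by positivity) hx.le
      linarith
    calc |Cconst μ ν| * l ^ (M + 4) = |Cconst μ ν| * (l * l ^ (M + 3)) := by ring
      _ ≤ |Cconst μ ν| * ((2 * α) * (1 + l) ^ (M + 3)) := by gcongr
      _ = (|Cconst μ ν| * (2 * 1)) * (1 + l) ^ (M + 3) * α := by ring
      _ ≤ ((M + 4) + K + |Cconst μ ν| * (2 * (M + 4))) * (1 + l) ^ (M + 3) * (1 + α) := by
        gcongr ?_ * _ * ?_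
        · have : |Cconst μ ν| * (2 * 1) ≤ |Cconst μ ν| * (2 * (M + 4)) := by
            gcongr; linarith
          linarith
        · linarith
  · have hx0 : 0 ≤ Real.log (t / e ^ 2) := Real.log_nonneg hx
    have hxt : t / (e : ℝ) ^ 2 ≤ t := div_le_self (by linarith) (one_le_pow₀ he')
    have hxN : t / (e : ℝ) ^ 2 < (⌊t⌋₊ : ℝ) + 1 := hxt.trans_lt (Nat.lt_floor_add_one t)
    have b1 := abs_quadSum_sub_quadSum_zero_le μ ν ht he
    have b2 := h _ hx
    simp only [← quadSum_zero_eq ⌊t⌋₊ μ ν hxN] at b2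
    have b3 : |Real.log (t / e ^ 2) ^ (M + 3 + 1) - l ^ (M + 4)| ≤
        (2 * α) * (M + 4) * (1 + l) ^ (M + 3) := by
      have := abs_pow_sub_pow_le (Real.log (t / e ^ 2)) l (M + 4)
      rw [abs_of_nonneg hx0, abs_of_nonneg hl0, max_eq_right (by linarith), hlogx,
        sub_sub_cancel_left, abs_neg, abs_of_nonneg (by positivity : 0 ≤ 2 * α)] at this
      rw [hlogx]
      refine this.trans ?_
      push_cast
      exact mul_le_mul_of_nonneg_left hlR (by positivity)
    have b4 : K * (1 + Real.log (t / e ^ 2)) ^ (M + 3) ≤ K * (1 + l) ^ (M + 3) := by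
      gcongr; linarith
    have tri : ∀ P Q c X Y : ℝ, |P - c * Y| ≤ |P - Q| + |Q - c * X| + |c| * |X - Y| := by
      intro P Q c X Y
      rw [← abs_mul]
      calc |P - c * Y| = |(P - Q) + (Q - c * X) + c * (X - Y)| := by congr 1; ring
        _ ≤ _ := (abs_add_le _ _).trans (add_le_add_left (abs_add_le _ _) _)
    refine (tri _ (quadSum ⌊t⌋₊ μ ν 0 (t / e ^ 2)) _ (Real.log (t / e ^ 2) ^ (M + 3 + 1)) _).trans ?_
    have b5 := mul_le_mul_of_nonneg_left b3 (abs_nonneg (Cconst μ ν))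
    have hMM : (μ : ℝ) + ν = M := by rw [hM]; push_cast; rfl
    rw [hMM] at b1
    calc _ ≤ M * α * (1 + l) ^ (M + 3) + K * (1 + l) ^ (M + 3) +
          |Cconst μ ν| * ((2 * α) * (M + 4) * (1 + l) ^ (M + 3)) :=
          add_le_add (add_le_add b1 (b2.trans b4)) b5
      _ ≤ (M + 4) * (1 + α) * (1 + l) ^ (M + 3) + K * (1 + α) * (1 + l) ^ (M + 3) +
          |Cconst μ ν| * ((2 * (1 + α)) * (M + 4) * (1 + l) ^ (M + 3)) := by
          have : K ≤ K * (1 + α) := by nlinarith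
          gcongr <;> linarith
      _ = _ := by ring

theorem sumDLogMulDLog_asymp (μ ν : ℕ) : ∃ K : ℝ, 0 ≤ K ∧ ∀ t : ℝ, 1 ≤ t →
    |sumDLogMulDLog μ ν t - 6 / Real.pi ^ 2 * (Cconst μ ν * Real.log t ^ (μ + ν + 4))| ≤
      K * (1 + Real.log t) ^ (μ + ν + 3) := by
  obtain ⟨K, hK, h⟩ := exists_abs_quadSum_sub_le μ ν
  set Z := ∑' e : ℕ, (1 + Real.log e) / (e : ℝ) ^ 2 with hZ
  have hZ0 : 0 ≤ Z := tsum_nonneg fun e => by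
    have := Real.log_natCast_nonneg e
    positivity
  refine ⟨K * Z, by positivity, fun t ht => ?_⟩
  set R := (1 + Real.log t) ^ (μ + ν + 3) with hR
  have hl0 : 0 ≤ Real.log t := Real.log_nonneg ht
  have H1 : HasSum (fun e : ℕ => (ArithmeticFunction.moebius e : ℝ) / (e : ℝ) ^ 2 *
      quadSum ⌊t⌋₊ μ ν (Real.log e) (t / e ^ 2)) (sumDLogMulDLog μ ν t) := by
    rw [sumDLogMulDLog_eq_sum_moebius μ ν ht]
    refine hasSum_sum_of_ne_finset_zero fun e he => ?_
    rcases Nat.eq_zero_or_pos e with rfl | he1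
    · simp
    · have h2 : t < e := by
        rw [← Nat.floor_lt (by linarith)]
        by_contra hc
        exact he (Finset.mem_Icc.2 ⟨he1, not_lt.1 hc⟩)
      rw [quadSum_of_lt_one, mul_zero]
      rw [div_lt_one (by positivity)]
      nlinarith
  have H2 := hasSum_moebius_div_sq.mul_right (Cconst μ ν * Real.log t ^ (μ + ν + 4))
  have H3 := H1.sub H2
  have H4 := (summable_one_add_log_div_sq.hasSum).mul_left (K * R)
  rw [← H3.tsum_eq, ← Real.norm_eq_abs]
  refine (tsum_of_norm_bounded H4 fun e => ?_).trans (le_of_eq (by rw [← hZ]; ring))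
  rcases Nat.eq_zero_or_pos e with rfl | he1
  · simp
  · rw [← mul_sub, Real.norm_eq_abs, abs_mul, abs_div, abs_of_nonneg (by positivity : (0 : ℝ) ≤
      (e : ℝ) ^ 2)]
    have hm : |(ArithmeticFunction.moebius e : ℝ)| ≤ 1 := by
      exact_mod_cast ArithmeticFunction.abs_moebius_le_one
    calc _ ≤ 1 / (e : ℝ) ^ 2 * (K * R * (1 + Real.log e)) := by
          gcongr
          exact h t ht e he1
      _ = _ := by ring

theorem divisors_prime_mul {p n : ℕ} (hp : p.Prime) (hn : n ≠ 0) :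
    (p * n).divisors = n.divisors ∪ n.divisors.image (fun a => p * a) := by
  ext d
  simp only [Nat.mem_divisors, Finset.mem_union, Finset.mem_image]
  constructor
  · rintro ⟨hd, -⟩
    by_cases hpd : p ∣ d
    · obtain ⟨c, rfl⟩ := hpd
      exact Or.inr ⟨c, ⟨Nat.dvd_of_mul_dvd_mul_left hp.pos hd, hn⟩, rfl⟩
    · exact Or.inl ⟨(((Nat.Prime.coprime_iff_not_dvd hp).2 hpd).symm).dvd_of_dvd_mul_left hd, hn⟩
  · rintro (⟨hd, -⟩ | ⟨c, ⟨hc, -⟩, rfl⟩)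
    · exact ⟨hd.mul_left p, mul_ne_zero hp.ne_zero hn⟩
    · exact ⟨Nat.mul_dvd_mul_left p hc, mul_ne_zero hp.ne_zero hn⟩

theorem dLog_prime_mul (ν : ℕ) {p n : ℕ} (hp : p.Prime) (hn : n ≠ 0) :
    dLog ν (p * n) = dLog ν n +
      (∑ k ∈ Finset.range (ν + 1), (ν.choose k : ℝ) * Real.log p ^ (ν - k) * dLog k n) -
      ∑ a ∈ n.divisors with p ∣ a, Real.log a ^ ν := by
  have hinj : Set.InjOn (fun a => p * a) (n.divisors : Set ℕ) := fun a _ b _ h =>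
    Nat.eq_of_mul_eq_mul_left hp.pos h
  have hinter : n.divisors ∩ n.divisors.image (fun a => p * a) =
      n.divisors.filter (fun a => p ∣ a) := by
    ext d
    simp only [Finset.mem_inter, Finset.mem_image, Finset.mem_filter, Nat.mem_divisors]
    constructor
    · rintro ⟨h, c, -, rfl⟩; exact ⟨h, dvd_mul_right p c⟩
    · rintro ⟨h, c, rfl⟩
      exact ⟨h, c, ⟨(dvd_mul_left c p).trans h.1, hn⟩, rfl⟩
  have himg : ∑ d ∈ n.divisors.image (fun a => p * a), Real.log d ^ ν =
      ∑ k ∈ Finset.range (ν + 1), (ν.choose k : ℝ) * Real.log p ^ (ν - k) * dLog k n := by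
    rw [Finset.sum_image hinj]
    simp only [dLog_eq_sum_divisors, Finset.mul_sum]
    rw [Finset.sum_comm]
    refine Finset.sum_congr rfl fun a ha => ?_
    have ha0 : a ≠ 0 := (Nat.pos_of_mem_divisors ha).ne'
    have hp0 : (p : ℝ) ≠ 0 := by exact_mod_cast hp.ne_zero
    rw [Nat.cast_mul, Real.log_mul hp0 (by exact_mod_cast ha0), add_comm, add_pow]
    exact Finset.sum_congr rfl fun k _ => by ring
  have h := Finset.sum_union_inter (s₁ := n.divisors)
    (s₂ := n.divisors.image (fun a => p * a)) (f := fun d : ℕ => Real.log d ^ ν)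
  rw [← divisors_prime_mul hp hn, hinter, himg, ← dLog_eq_sum_divisors,
    ← dLog_eq_sum_divisors] at h
  linarith

theorem card_divisors_prime_mul_le {p n : ℕ} (hp : p.Prime) (hn : n ≠ 0) :
    (p * n).divisors.card ≤ 2 * n.divisors.card := by
  rw [divisors_prime_mul hp hn, two_mul]
  exact (Finset.card_union_le _ _).trans (Nat.add_le_add_left Finset.card_image_le _)

theorem card_filter_dvd_divisors_le {p n : ℕ} (hp : p.Prime) (hn : n ≠ 0) :
    (n.divisors.filter (fun a => p ∣ a)).card ≤ if p ∣ n then (n / p).divisors.card else 0 := by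
  split_ifs with h
  · obtain ⟨m, rfl⟩ := h
    rw [Nat.mul_div_cancel_left _ hp.pos]
    refine (Finset.card_le_card ?_).trans (Finset.card_image_le (f := fun a => p * a))
    intro a ha
    obtain ⟨h1, c, rfl⟩ := Finset.mem_filter.1 ha
    refine Finset.mem_image.2 ⟨c, Nat.mem_divisors.2
      ⟨Nat.dvd_of_mul_dvd_mul_left hp.pos (Nat.mem_divisors.1 h1).1, ?_⟩, rfl⟩
    rintro rfl
    simp at hn
  · rw [Nat.le_zero, Finset.card_eq_zero, Finset.filter_eq_empty_iff]
    exact fun a ha hpa => h (hpa.trans (Nat.mem_divisors.1 ha).1)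

theorem sum_log_pow_le_card_mul {t : ℝ} {n : ℕ} (hnt : (n : ℝ) ≤ t)
    (s : Finset ℕ) (hs : s ⊆ n.divisors) (k : ℕ) :
    ∑ a ∈ s, Real.log a ^ k ≤ s.card * Real.log t ^ k := by
  rw [← nsmul_eq_mul]
  refine Finset.sum_le_card_nsmul _ _ _ fun a ha => ?_
  have ha' := hs ha
  have h1 : (1 : ℝ) ≤ a := by exact_mod_cast Nat.pos_of_mem_divisors ha'
  have h2 : (a : ℝ) ≤ t := le_trans (by exact_mod_cast Nat.divisor_le ha') hnt
  exact pow_le_pow_left₀ (Real.log_nonneg h1) (Real.log_le_log (by linarith) h2) k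

theorem dLog_nonneg (μ n : ℕ) : 0 ≤ dLog μ n := by
  rw [dLog_eq_sum_divisors]
  exact Finset.sum_nonneg fun a _ => pow_nonneg (Real.log_natCast_nonneg a) μ

theorem sum_dLog_mul_overlap_le (μ ν : ℕ) {t : ℝ} (ht : 1 ≤ t) {p : ℕ} (hp : p.Prime) :
    ∑ n ∈ Finset.Icc 1 ⌊t⌋₊, dLog μ n * (∑ a ∈ n.divisors with p ∣ a, Real.log a ^ ν) / n ≤
      2 / p * Real.log t ^ (μ + ν) * sumDLogMulDLog 0 0 t := by
  have hl : 0 ≤ Real.log t := Real.log_nonneg ht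
  have hp0 : (0 : ℝ) < p := by exact_mod_cast hp.pos
  set N := ⌊t⌋₊ with hN
  set f : ℕ → ℝ := fun n => if n ≤ N then
    Real.log t ^ (μ + ν) * (n.divisors.card * (n / p).divisors.card) / n else 0 with hf
  have h1 : ∀ n ∈ Finset.Icc 1 N, dLog μ n * (∑ a ∈ n.divisors with p ∣ a, Real.log a ^ ν) / n ≤
      if p ∣ n then f n else 0 := by
    intro n hn
    obtain ⟨-, hnt, -⟩ := one_le_div_of_mem_Icc_floor ht hn
    obtain ⟨hn1, hnN⟩ := Finset.mem_Icc.1 hn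
    have b1 : dLog μ n ≤ n.divisors.card * Real.log t ^ μ := by
      rw [dLog_eq_sum_divisors]
      exact sum_log_pow_le_card_mul hnt _ subset_rfl μ
    have b2 := sum_log_pow_le_card_mul hnt _ (Finset.filter_subset (fun a => p ∣ a) n.divisors) ν
    have b3 : ((n.divisors.filter (fun a => p ∣ a)).card : ℝ) ≤
        if p ∣ n then ((n / p).divisors.card : ℝ) else 0 := by
      have := card_filter_dvd_divisors_le hp (by omega : n ≠ 0)
      split_ifs at this ⊢ <;> exact_mod_cast this
    have b0 : 0 ≤ ∑ a ∈ n.divisors with p ∣ a, Real.log a ^ ν :=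
      Finset.sum_nonneg fun a _ => pow_nonneg (Real.log_natCast_nonneg a) ν
    calc _ ≤ (n.divisors.card * Real.log t ^ μ) *
          ((if p ∣ n then ((n / p).divisors.card : ℝ) else 0) * Real.log t ^ ν) / n := by
          gcongr
          exact b2.trans (by gcongr)
      _ = if p ∣ n then f n else 0 := by
          simp only [hf, if_pos hnN]
          split_ifs
          · ring
          · simp
  refine (Finset.sum_le_sum h1).trans ?_
  rw [sum_Icc_ite_dvd_eq hp.pos f (fun m hm => if_neg (not_le.2 hm))]
  unfold sumDLogMulDLog
  rw [Finset.mul_sum]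
  refine Finset.sum_le_sum fun m hm => ?_
  have hm1 : 1 ≤ m := (Finset.mem_Icc.1 hm).1
  have hm0 : (0 : ℝ) < m := by exact_mod_cast hm1
  have e0 : dLog 0 m = m.divisors.card := by simp [dLog_eq_sum_divisors]
  rw [e0]
  simp only [hf]
  split_ifs
  · rw [Nat.mul_div_cancel_left _ hp.pos]
    have c : ((p * m).divisors.card : ℝ) ≤ 2 * m.divisors.card := by
      exact_mod_cast card_divisors_prime_mul_le hp (by omega : m ≠ 0)
    calc _ ≤ Real.log t ^ (μ + ν) * ((2 * m.divisors.card) * m.divisors.card) / (p * m : ℕ) := by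
          gcongr
      _ = _ := by push_cast; field_simp
  · positivity

theorem sum_dLog_mul_dLog_prime_mul_eq (μ ν : ℕ) (t : ℝ) {p : ℕ} (hp : p.Prime) :
    ∑ n ∈ Finset.Icc 1 ⌊t⌋₊, dLog μ n * dLog ν (p * n) / n =
      2 * sumDLogMulDLog μ ν t +
        (∑ k ∈ Finset.range ν, (ν.choose k : ℝ) * Real.log p ^ (ν - k) * sumDLogMulDLog μ k t) -
        ∑ n ∈ Finset.Icc 1 ⌊t⌋₊, dLog μ n * (∑ a ∈ n.divisors with p ∣ a, Real.log a ^ ν) / n := by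
  have e : ∀ n ∈ Finset.Icc 1 ⌊t⌋₊, dLog μ n * dLog ν (p * n) / n =
      2 * (dLog μ n * dLog ν n / n) +
      (∑ k ∈ Finset.range ν, (ν.choose k : ℝ) * Real.log p ^ (ν - k) *
        (dLog μ n * dLog k n / n)) -
      dLog μ n * (∑ a ∈ n.divisors with p ∣ a, Real.log a ^ ν) / n := by
    intro n hn
    have hn1 := (Finset.mem_Icc.1 hn).1
    rw [dLog_prime_mul ν hp (by omega), Finset.sum_range_succ]
    have : ∑ k ∈ Finset.range ν, (ν.choose k : ℝ) * Real.log p ^ (ν - k) *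
        (dLog μ n * dLog k n / n) = dLog μ n / n *
        ∑ k ∈ Finset.range ν, (ν.choose k : ℝ) * Real.log p ^ (ν - k) * dLog k n := by
      rw [Finset.mul_sum]
      exact Finset.sum_congr rfl fun k _ => by ring
    rw [this, Nat.choose_self, Nat.sub_self]
    push_cast
    ring
  rw [Finset.sum_congr rfl e, Finset.sum_sub_distrib, Finset.sum_add_distrib, ← Finset.mul_sum,
    Finset.sum_comm]
  unfold sumDLogMulDLog
  simp only [Finset.mul_sum]

theorem shifted_divisor_log_sum (μ ν : ℕ) :
    ∃ K : ℝ, 0 < K ∧ ∀ t : ℝ, 3 ≤ t → ∀ p : ℕ, p.Prime → (p : ℝ) ≤ t →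
      |(∑ n ∈ Finset.Icc 1 ⌊t⌋₊, dLog μ n * dLog ν (p * n) / n) -
          6 / Real.pi ^ 2 *
            (2 * Cconst μ ν * Real.log t ^ (μ + ν + 4) +
              ∑ k ∈ Finset.range ν,
                (Nat.choose ν k : ℝ) * Real.log p ^ (ν - k) * Real.log t ^ (μ + k + 4) *
                  Cconst μ k)|
        ≤ K * (Real.log t ^ (μ + ν + 4) / p + Real.log t ^ (μ + ν + 3)) := by
  choose Kf hKf0 hKf using sumDLogMulDLog_asymp μ
  obtain ⟨K0, hK00, hK0⟩ := sumDLogMulDLog_asymp 0 0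
  set A : ℝ := 2 * Kf ν + ∑ k ∈ Finset.range ν, (ν.choose k : ℝ) * Kf k with hA
  have hA0 : 0 ≤ A := by
    have := hKf0 ν
    have : 0 ≤ ∑ k ∈ Finset.range ν, (ν.choose k : ℝ) * Kf k :=
      Finset.sum_nonneg fun k _ => mul_nonneg (Nat.cast_nonneg _) (hKf0 k)
    linarith
  set B : ℝ := 6 / Real.pi ^ 2 * |Cconst 0 0| + K0 with hB
  have hB0 : 0 ≤ B := by positivity
  refine ⟨2 ^ (μ + ν + 3) * A + 2 * (2 ^ 4 * B) + 1, by positivity, fun t ht p hp hpt => ?_⟩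
  have ht1 : 1 ≤ t := by linarith
  set l := Real.log t with hl
  have hl1 : 1 ≤ l := by
    rw [hl, Real.le_log_iff_exp_le (by linarith)]
    linarith [Real.exp_one_lt_d9]
  have hl0 : 0 ≤ l := by linarith
  have hp1 : (1 : ℝ) ≤ p := by exact_mod_cast hp.one_lt.le
  have hq0 : 0 ≤ Real.log p := Real.log_nonneg hp1
  have hql : Real.log p ≤ 1 + l := by
    have := Real.log_le_log (by linarith) hpt
    linarith
  have hpow : ∀ m : ℕ, (1 + l) ^ m ≤ 2 ^ m * l ^ m := fun m => by
    rw [← mul_pow]; exact pow_le_pow_left₀ (by linarith) (by linarith) m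
  rw [sum_dLog_mul_dLog_prime_mul_eq μ ν t hp]
  set E := ∑ n ∈ Finset.Icc 1 ⌊t⌋₊,
    dLog μ n * (∑ a ∈ n.divisors with p ∣ a, Real.log a ^ ν) / n with hE
  have hE0 : 0 ≤ E := Finset.sum_nonneg fun n _ => div_nonneg (mul_nonneg (dLog_nonneg μ n)
    (Finset.sum_nonneg fun a _ => pow_nonneg (Real.log_natCast_nonneg a) ν)) (Nat.cast_nonneg n)
  have hS : sumDLogMulDLog 0 0 t ≤ 2 ^ 4 * B * l ^ 4 := by
    have h1 := (abs_le.1 (hK0 t ht1)).2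
    simp only [zero_add] at h1
    have h2 : Cconst 0 0 * l ^ 4 ≤ |Cconst 0 0| * (1 + l) ^ 4 := by
      refine mul_le_mul (le_abs_self _) (pow_le_pow_left₀ hl0 (by linarith) 4) (by positivity)
        (abs_nonneg _)
    have h3 : (1 + l) ^ 3 ≤ (1 + l) ^ 4 := pow_le_pow_right₀ (by linarith) (by norm_num)
    have h4 := mul_le_mul_of_nonneg_left h2 (by positivity : 0 ≤ 6 / Real.pi ^ 2)
    have h5 := mul_le_mul_of_nonneg_left h3 hK00
    have h6 := mul_le_mul_of_nonneg_left (hpow 4) hB0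
    calc _ ≤ B * (1 + l) ^ 4 := by rw [hB]; linarith
      _ ≤ _ := by linarith
  have hEle : E ≤ 2 * (2 ^ 4 * B) * (l ^ (μ + ν + 4) / p) := by
    refine (sum_dLog_mul_overlap_le μ ν ht1 hp).trans ?_
    calc _ ≤ 2 / p * l ^ (μ + ν) * (2 ^ 4 * B * l ^ 4) :=
          mul_le_mul_of_nonneg_left hS (by positivity)
      _ = _ := by ring
  have hterm : ∀ k ∈ Finset.range ν, |(ν.choose k : ℝ) * Real.log p ^ (ν - k) *
      (sumDLogMulDLog μ k t - 6 / Real.pi ^ 2 * (Cconst μ k * l ^ (μ + k + 4)))| ≤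
      (ν.choose k : ℝ) * Kf k * (1 + l) ^ (μ + ν + 3) := by
    intro k hk
    have hk' : k < ν := Finset.mem_range.1 hk
    rw [abs_mul, abs_of_nonneg (by positivity)]
    calc _ ≤ (ν.choose k : ℝ) * (1 + l) ^ (ν - k) * (Kf k * (1 + l) ^ (μ + k + 3)) := by
          have := hKf k t ht1
          gcongr
      _ = (ν.choose k : ℝ) * Kf k * ((1 + l) ^ (ν - k) * (1 + l) ^ (μ + k + 3)) := by ring
      _ = _ := by rw [← pow_add, show ν - k + (μ + k + 3) = μ + ν + 3 by omega]
  have hmain : |2 * (sumDLogMulDLog μ ν t - 6 / Real.pi ^ 2 * (Cconst μ ν * l ^ (μ + ν + 4))) +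
      ∑ k ∈ Finset.range ν, (ν.choose k : ℝ) * Real.log p ^ (ν - k) *
        (sumDLogMulDLog μ k t - 6 / Real.pi ^ 2 * (Cconst μ k * l ^ (μ + k + 4)))| ≤
      2 ^ (μ + ν + 3) * A * l ^ (μ + ν + 3) := by
    refine (abs_add_le _ _).trans ?_
    have h1 := (Finset.abs_sum_le_sum_abs _ _).trans (Finset.sum_le_sum hterm)
    rw [← Finset.sum_mul] at h1
    have h2 := hKf ν t ht1
    rw [abs_mul, abs_of_pos (by norm_num : (0 : ℝ) < 2)]
    have h3 := mul_le_mul_of_nonneg_left (hpow (μ + ν + 3)) hA0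
    calc _ ≤ A * (1 + l) ^ (μ + ν + 3) := by rw [hA]; linarith
      _ ≤ _ := by linarith
  have hsplit : 2 * sumDLogMulDLog μ ν t +
      (∑ k ∈ Finset.range ν, (ν.choose k : ℝ) * Real.log p ^ (ν - k) * sumDLogMulDLog μ k t) - E -
      6 / Real.pi ^ 2 * (2 * Cconst μ ν * l ^ (μ + ν + 4) + ∑ k ∈ Finset.range ν,
        (ν.choose k : ℝ) * Real.log p ^ (ν - k) * l ^ (μ + k + 4) * Cconst μ k) =
      (2 * (sumDLogMulDLog μ ν t - 6 / Real.pi ^ 2 * (Cconst μ ν * l ^ (μ + ν + 4))) +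
      ∑ k ∈ Finset.range ν, (ν.choose k : ℝ) * Real.log p ^ (ν - k) *
        (sumDLogMulDLog μ k t - 6 / Real.pi ^ 2 * (Cconst μ k * l ^ (μ + k + 4)))) - E := by
    have : ∑ k ∈ Finset.range ν, (ν.choose k : ℝ) * Real.log p ^ (ν - k) *
        (sumDLogMulDLog μ k t - 6 / Real.pi ^ 2 * (Cconst μ k * l ^ (μ + k + 4))) =
        (∑ k ∈ Finset.range ν, (ν.choose k : ℝ) * Real.log p ^ (ν - k) * sumDLogMulDLog μ k t) -
        6 / Real.pi ^ 2 * ∑ k ∈ Finset.range ν,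
        (ν.choose k : ℝ) * Real.log p ^ (ν - k) * l ^ (μ + k + 4) * Cconst μ k := by
      rw [Finset.mul_sum, ← Finset.sum_sub_distrib]
      exact Finset.sum_congr rfl fun k _ => by ring
    rw [this]
    ring
  rw [hsplit]
  refine (abs_sub _ _).trans ?_
  rw [abs_of_nonneg hE0]
  have hX : 0 ≤ l ^ (μ + ν + 4) / p := by positivity
  have hY : 0 ≤ l ^ (μ + ν + 3) := by positivity
  have hAA : 0 ≤ 2 ^ (μ + ν + 3) * A := by positivity
  have := mul_nonneg hAA hX
  have := mul_nonneg hB0 hY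
  refine (add_le_add hmain hEle).trans ?_
  nlinarith
end

section
/- Let μ ≥ 0 and ν ≥ 1 be integers and set C(μ,ν) = (μ!·ν!/(μ+ν+4)!)·(binom(μ+ν+2, μ+1) − 1). Then 2·C(μ,ν)/(μ+ν+5) + Σ_{k=0}^{ν−1} binom(ν,k)·(ν−k)!·(μ+k+4)!/(μ+ν+5)!·C(μ,k) = (μ!·ν!/(μ+ν+5)!)·(2·binom(μ+ν+2, ν+1) + binom(μ+ν+2, ν) − ν − 3). Moreover, for ν = 0 one has 2·C(μ,0)/(μ+5) = 2/((μ+5)(μ+4)(μ+3)(μ+2)). -/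
theorem sum_range_choose_sub_one (μ ν : ℕ) :
    ∑ k ∈ Finset.range ν, ((Nat.choose (μ + k + 2) (μ + 1) : ℝ) - 1) =
      (Nat.choose (μ + ν + 2) (μ + 2) : ℝ) - ν - 1 := by
  induction ν with
  | zero => simp
  | succ n ih =>
    rw [Finset.sum_range_succ, ih, show μ + (n + 1) + 2 = (μ + n + 2) + 1 by ring,
      Nat.choose_succ_succ' (μ + n + 2) (μ + 1)]
    push_cast
    ring

theorem choose_mul_factorial_mul_Cconst (μ : ℕ) {ν k : ℕ} (hk : k ≤ ν) :
    (Nat.choose ν k : ℝ) * (Nat.factorial (ν - k) : ℝ) *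
        (Nat.factorial (μ + k + 4) : ℝ) / (Nat.factorial (μ + ν + 5) : ℝ) * Cconst μ k =
      (Nat.factorial μ : ℝ) * (Nat.factorial ν : ℝ) / (Nat.factorial (μ + ν + 5) : ℝ) *
        ((Nat.choose (μ + k + 2) (μ + 1) : ℝ) - 1) := by
  have h : (Nat.choose ν k : ℝ) * (Nat.factorial k : ℝ) * (Nat.factorial (ν - k) : ℝ) =
      (Nat.factorial ν : ℝ) := mod_cast Nat.choose_mul_factorial_mul_factorial hk
  have h₁ : (Nat.factorial (μ + k + 4) : ℝ) ≠ 0 := mod_cast Nat.factorial_ne_zero _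
  rw [Cconst, ← h]
  field_simp

theorem two_mul_Cconst_div (μ ν : ℕ) :
    2 * Cconst μ ν / ((μ : ℝ) + ν + 5) =
      (Nat.factorial μ : ℝ) * (Nat.factorial ν : ℝ) / (Nat.factorial (μ + ν + 5) : ℝ) *
        (2 * ((Nat.choose (μ + ν + 2) (μ + 1) : ℝ) - 1)) := by
  have h : (Nat.factorial (μ + ν + 5) : ℝ) =
      ((μ : ℝ) + ν + 5) * (Nat.factorial (μ + ν + 4) : ℝ) := by
    rw [Nat.factorial_succ (μ + ν + 4)]
    push_cast
    ring
  have h₁ : (Nat.factorial (μ + ν + 4) : ℝ) ≠ 0 := mod_cast Nat.factorial_ne_zero _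
  have h₂ : (μ : ℝ) + ν + 5 ≠ 0 := by positivity
  rw [Cconst, h]
  field_simp

theorem Cconst_zero_right (μ : ℕ) :
    Cconst μ 0 = 1 / (((μ : ℝ) + 4) * ((μ : ℝ) + 3) * ((μ : ℝ) + 2)) := by
  have h : (Nat.factorial (μ + 4) : ℝ) =
      ((μ : ℝ) + 4) * (μ + 3) * (μ + 2) * (μ + 1) * (Nat.factorial μ : ℝ) := by
    simp only [Nat.factorial_succ]
    push_cast
    ring
  have h₁ : (Nat.factorial μ : ℝ) ≠ 0 := mod_cast Nat.factorial_ne_zero _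
  have h₂ : (μ : ℝ) + 1 ≠ 0 := by positivity
  have h₃ : (Nat.choose (μ + 2) (μ + 1) : ℝ) = μ + 2 := by
    rw [Nat.choose_succ_self_right (μ + 1)]
    push_cast
    ring
  rw [Cconst, add_zero, h, h₃, Nat.factorial_zero, Nat.cast_one]
  field_simp
  ring

theorem Aconst_evaluation (μ ν : ℕ) (hν : 1 ≤ ν) :
    (2 * Cconst μ ν / ((μ : ℝ) + ν + 5) +
        ∑ k ∈ Finset.range ν,
          (Nat.choose ν k : ℝ) * (Nat.factorial (ν - k) : ℝ) *
            (Nat.factorial (μ + k + 4) : ℝ) / (Nat.factorial (μ + ν + 5) : ℝ) * Cconst μ k =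
      (Nat.factorial μ : ℝ) * (Nat.factorial ν : ℝ) / (Nat.factorial (μ + ν + 5) : ℝ) *
        (2 * (Nat.choose (μ + ν + 2) (ν + 1) : ℝ) + (Nat.choose (μ + ν + 2) ν : ℝ) -
          (ν : ℝ) - 3)) ∧
    2 * Cconst μ 0 / ((μ : ℝ) + 5) =
      2 / (((μ : ℝ) + 5) * ((μ : ℝ) + 4) * ((μ : ℝ) + 3) * ((μ : ℝ) + 2)) := by
  constructor
  · have h₁ : Nat.choose (μ + ν + 2) (μ + 1) = Nat.choose (μ + ν + 2) (ν + 1) :=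
      Nat.choose_symm_of_eq_add (by ring)
    have h₂ : Nat.choose (μ + ν + 2) (μ + 2) = Nat.choose (μ + ν + 2) ν :=
      Nat.choose_symm_of_eq_add (by ring)
    rw [two_mul_Cconst_div, Finset.sum_congr rfl fun k hk =>
      choose_mul_factorial_mul_Cconst μ (Finset.mem_range.mp hk).le,
      ← Finset.mul_sum, sum_range_choose_sub_one, h₁, h₂]
    ring
  · rw [Cconst_zero_right]
    field_simp
end

section
/- Let n₁, n₂, n₃, n₄ be nonnegative integers. Then Σ_{a=0}^{n₁} Σ_{c=0}^{n₂} Σ_{e=0}^{n₃} Σ_{g=0}^{n₄} binom(n₁,a)·binom(n₂,c)·binom(n₃,e)·binom(n₄,g)·(a+e)!·(c+n₃−e)!·(n₁−a+g)!·(n₂−c+n₄−g)! = n₁!·n₂!·n₃!·n₄!·Σ_{a=0}^{n₁} Σ_{c=0}^{n₂} binom(n₃+a+c+1, n₃)·binom(n₄+1+n₁+n₂−a−c, n₄). -/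
open Finset in
theorem sum_antidiagonal_choose_mul_factorial_mul_factorial (n a c : ℕ) :
    ∑ p ∈ antidiagonal n, n.choose p.1 * ((a + p.1).factorial * (c + p.2).factorial) =
      n.factorial * a.factorial * c.factorial * (n + a + c + 1).choose n := by
  induction n generalizing a c with
  | zero => simp
  | succ n ih =>
    have pascal := sum_antidiagonal_choose_succ_nsmul
      (fun i j => (a + i).factorial * (c + j).factorial) n
    simp only [smul_eq_mul] at pascal
    have left : ∑ p ∈ antidiagonal n,
        n.choose p.1 * ((a + p.1).factorial * (c + (p.2 + 1)).factorial) =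
          n.factorial * a.factorial * (c + 1).factorial * (n + a + c + 2).choose n := by
      rw [show n + a + c + 2 = n + a + (c + 1) + 1 by omega, ← ih]
      simp only [add_comm, add_left_comm]
    have right : ∑ p ∈ antidiagonal n,
        n.choose p.2 * ((a + (p.1 + 1)).factorial * (c + p.2).factorial) =
          n.factorial * (a + 1).factorial * c.factorial * (n + a + c + 2).choose n := by
      rw [show n + a + c + 2 = n + (a + 1) + c + 1 by omega, ← ih]
      refine sum_congr rfl fun p hp => ?_
      rw [Nat.choose_symm_of_eq_add (mem_antidiagonal.mp hp).symm, add_right_comm a, add_assoc a]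
    have absorb := Nat.choose_succ_right_eq (n + a + c + 2) n
    rw [show n + a + c + 2 - n = a + c + 2 by omega] at absorb
    rw [pascal, left, right, show n + 1 + a + c + 1 = n + a + c + 2 by omega]
    simp only [Nat.factorial_succ]
    linear_combination (n.factorial * a.factorial * c.factorial) * absorb.symm

theorem sum_range_choose_mul_factorial_mul_factorial (n a c : ℕ) :
    ∑ e ∈ Finset.range (n + 1), n.choose e * ((a + e).factorial * (c + n - e).factorial) =
      n.factorial * a.factorial * c.factorial * (n + a + c + 1).choose n := by
  rw [← sum_antidiagonal_choose_mul_factorial_mul_factorial,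
    Finset.Nat.sum_antidiagonal_eq_sum_range_succ
      (fun i j => n.choose i * ((a + i).factorial * (c + j).factorial))]
  refine Finset.sum_congr rfl fun e he => ?_
  rw [Nat.add_sub_assoc (Finset.mem_range_succ_iff.mp he)]

theorem quadruple_binomial_factorial_identity (n₁ n₂ n₃ n₄ : ℕ) :
    (∑ a ∈ Finset.range (n₁ + 1), ∑ c ∈ Finset.range (n₂ + 1),
        ∑ e ∈ Finset.range (n₃ + 1), ∑ g ∈ Finset.range (n₄ + 1),
          Nat.choose n₁ a * Nat.choose n₂ c * Nat.choose n₃ e * Nat.choose n₄ g *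
            Nat.factorial (a + e) * Nat.factorial (c + n₃ - e) *
            Nat.factorial (n₁ - a + g) * Nat.factorial (n₂ - c + n₄ - g)) =
      Nat.factorial n₁ * Nat.factorial n₂ * Nat.factorial n₃ * Nat.factorial n₄ *
        ∑ a ∈ Finset.range (n₁ + 1), ∑ c ∈ Finset.range (n₂ + 1),
          Nat.choose (n₃ + a + c + 1) n₃ * Nat.choose (n₄ + 1 + n₁ + n₂ - a - c) n₄ := by
  simp only [Finset.mul_sum]
  refine Finset.sum_congr rfl fun a ha => Finset.sum_congr rfl fun c hc => ?_
  have ha := Finset.mem_range_succ_iff.mp ha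
  have hc := Finset.mem_range_succ_iff.mp hc
  calc
    _ = n₁.choose a * n₂.choose c *
        ((∑ e ∈ Finset.range (n₃ + 1),
            n₃.choose e * ((a + e).factorial * (c + n₃ - e).factorial)) *
          ∑ g ∈ Finset.range (n₄ + 1),
            n₄.choose g * ((n₁ - a + g).factorial * (n₂ - c + n₄ - g).factorial)) := by
      rw [Finset.sum_mul_sum]
      simp only [Finset.mul_sum]
      refine Finset.sum_congr rfl fun e _ => Finset.sum_congr rfl fun g _ => ?_
      ring
    _ = _ := by
      rw [sum_range_choose_mul_factorial_mul_factorial,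
        sum_range_choose_mul_factorial_mul_factorial,
        show n₄ + (n₁ - a) + (n₂ - c) + 1 = n₄ + 1 + n₁ + n₂ - a - c by omega,
        ← Nat.choose_mul_factorial_mul_factorial ha,
        ← Nat.choose_mul_factorial_mul_factorial hc]
      ring
end

section
/- Let b, d, n be nonnegative integers. Then Σ_{g=0}^{n} binom(n,g)·(b+g)!·(d+n−g)! = n!·b!·d!·binom(n+b+d+1, b+d+1). -/
open Finset in
theorem sum_antidiagonal_choose_mul_factorial_mul_factorial_s13 (b d n : ℕ) :
    ∑ ij ∈ antidiagonal n, n.choose ij.1 * ((b + ij.1).factorial * (d + ij.2).factorial) =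
      n.factorial * b.factorial * d.factorial * (n + b + d + 1).choose (b + d + 1) := by
  induction n generalizing b d with
  | zero => simp
  | succ n ih =>
    have hsucc := sum_antidiagonal_choose_succ_mul (R := ℕ)
      (fun i j => (b + i).factorial * (d + j).factorial) n
    have hd := ih b (d + 1)
    have hb := ih (b + 1) d
    have hswap : ∑ ij ∈ antidiagonal n,
        n.choose ij.2 * ((b + (ij.1 + 1)).factorial * (d + ij.2).factorial) =
        ∑ ij ∈ antidiagonal n,
          n.choose ij.1 * ((b + 1 + ij.1).factorial * (d + ij.2).factorial) := by
      refine sum_congr rfl fun ij hij => ?_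
      rw [← Nat.choose_symm_of_eq_add (mem_antidiagonal.mp hij).symm, add_right_comm b 1, add_assoc]
    have hchoose := Nat.choose_succ_right_eq (n + b + d + 2) (b + d + 1)
    rw [show n + b + d + 2 - (b + d + 1) = n + 1 by lia] at hchoose
    have hassoc : ∑ ij ∈ antidiagonal n,
        n.choose ij.1 * ((b + ij.1).factorial * (d + (ij.2 + 1)).factorial) =
        ∑ ij ∈ antidiagonal n,
          n.choose ij.1 * ((b + ij.1).factorial * (d + 1 + ij.2).factorial) :=
      sum_congr rfl fun ij _ => by rw [add_right_comm d 1, add_assoc]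
    simp only [Nat.cast_id] at hsucc
    rw [hsucc, hassoc, hswap, hd, hb]
    simp only [show n + b + (d + 1) + 1 = n + b + d + 2 by ring,
      show n + (b + 1) + d + 1 = n + b + d + 2 by ring,
      show n + 1 + b + d + 1 = n + b + d + 2 by ring,
      show b + (d + 1) + 1 = b + d + 1 + 1 by ring,
      show b + 1 + d + 1 = b + d + 1 + 1 by ring, Nat.factorial_succ]
    linear_combination n.factorial * b.factorial * d.factorial * hchoose

theorem binomial_factorial_convolution_identity (b d n : ℕ) :
    (∑ g ∈ Finset.range (n + 1),
        Nat.choose n g * Nat.factorial (b + g) * Nat.factorial (d + n - g)) =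
      Nat.factorial n * Nat.factorial b * Nat.factorial d *
        Nat.choose (n + b + d + 1) (b + d + 1) := by
  rw [← sum_antidiagonal_choose_mul_factorial_mul_factorial_s13,
    Finset.Nat.sum_antidiagonal_eq_sum_range_succ_mk]
  refine Finset.sum_congr rfl fun g hg => ?_
  rw [mul_assoc, Nat.add_sub_assoc (Finset.mem_range_succ_iff.mp hg)]
end
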